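/- Let n ≥ 2, q ≥ 0 and p ∈ ℝ, and suppose the Liouville property holds for (p,q) in dimension n. Then there exists a constant C = C(n,p,q) > 0 such that for every x₀ ∈ ℝ^n, every R > 0 and every positive classical solution u of Δu + |∇u|^q u^p = 0 on the ball B(x₀, 2R) ⊂ ℝ^n, the Harnack inequality sup_{B(x₀,R)} u ≤ C · inf_{B(x₀,R)} u holds. -/

import Mathlib

open scoped BigOperators

/-- The Euclidean Laplacian of `u : ℝⁿ → ℝ`, defined as the sum of the second
partial derivatives in the coordinate directions. -/
noncomputable def elaplacian {n : ℕ} (u : EuclideanSpace ℝ (Fin n) → ℝ)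
    (x : EuclideanSpace ℝ (Fin n)) : ℝ :=
  ∑ i : Fin n, fderiv ℝ (fun y => fderiv ℝ u y (EuclideanSpace.single i 1)) x
    (EuclideanSpace.single i 1)

section

open MeasureTheory Filter Topology Set
open scoped ContDiff

/-- Euclidean `n`-space. -/
abbrev Euc (n : ℕ) := EuclideanSpace ℝ (Fin n)

/-- The `i`-th partial derivative. -/
noncomputable def pd {n : ℕ} (i : Fin n) (f : Euc n → ℝ) (x : Euc n) : ℝ :=
  fderiv ℝ f x (EuclideanSpace.single i 1)

section PartialDerivatives

variable {n : ℕ} {f g : Euc n → ℝ} {x : Euc n} {i j : Fin n}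

lemma elaplacian_eq_sum_pd (f : Euc n → ℝ) (x : Euc n) :
    elaplacian f x = ∑ i, pd i (pd i f) x := rfl

lemma ContDiff.pd {m k : WithTop ℕ∞} (hf : ContDiff ℝ k f) (h : m + 1 ≤ k) (i : Fin n) :
    ContDiff ℝ m (pd i f) :=
  (hf.fderiv_right h).clm_apply contDiff_const

lemma fderiv_apply_eq_sum_pd (f : Euc n → ℝ) (x v : Euc n) :
    fderiv ℝ f x v = ∑ i, v i * pd i f x := by
  conv_lhs => rw [← (EuclideanSpace.basisFun (Fin n) ℝ).sum_repr v]
  simp [pd, map_sum]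

lemma norm_fderiv_sq_eq_sum_pd (f : Euc n → ℝ) (x : Euc n) :
    ‖fderiv ℝ f x‖ ^ 2 = ∑ i, pd i f x ^ 2 := by
  have h := (InnerProductSpace.toDual ℝ (Euc n)).symm.norm_map (fderiv ℝ f x)
  rw [← h, EuclideanSpace.norm_sq_eq]
  refine Finset.sum_congr rfl fun i _ => ?_
  have : pd i f x = ((InnerProductSpace.toDual ℝ (Euc n)).symm (fderiv ℝ f x)) i := by
    have h2 := InnerProductSpace.toDual_symm_apply (𝕜 := ℝ) (x := EuclideanSpace.single i (1 : ℝ))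
      (y := fderiv ℝ f x)
    rw [pd, ← h2, EuclideanSpace.inner_single_right]
    simp
  rw [this, Real.norm_eq_abs, sq_abs]

lemma abs_pd_le (f : Euc n → ℝ) (x : Euc n) (i : Fin n) : |pd i f x| ≤ ‖fderiv ℝ f x‖ := by
  have h := (fderiv ℝ f x).le_opNorm (EuclideanSpace.single i 1)
  simpa [pd] using h

lemma pd_comm (hf : ContDiffAt ℝ 2 f x) (i j : Fin n) : pd i (pd j f) x = pd j (pd i f) x := by
  have h1 : DifferentiableAt ℝ (fderiv ℝ f) x :=
    (hf.fderiv_right (m := 1) (by norm_num)).differentiableAt (by norm_num)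
  have key : ∀ a b : Fin n, pd a (pd b f) x =
      fderiv ℝ (fderiv ℝ f) x (EuclideanSpace.single a 1) (EuclideanSpace.single b 1) := by
    intro a b
    have : pd b f = fun y => fderiv ℝ f y (EuclideanSpace.single b 1) := rfl
    rw [pd, this, fderiv_clm_apply h1 (differentiableAt_const _)]
    simp
  rw [key, key]
  exact (hf.isSymmSndFDerivAt (by simp)) _ _

lemma pd_congr (h : f =ᶠ[𝓝 x] g) (i : Fin n) : pd i f x = pd i g x := by
  rw [pd, pd, h.fderiv_eq]

lemma pd_eventuallyEq (h : f =ᶠ[𝓝 x] g) (i : Fin n) : pd i f =ᶠ[𝓝 x] pd i g :=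
  h.eventuallyEq_nhds.mono fun _ hy => pd_congr hy i

lemma elaplacian_congr (h : f =ᶠ[𝓝 x] g) : elaplacian f x = elaplacian g x :=
  Finset.sum_congr rfl fun i _ => pd_congr (pd_eventuallyEq h i) i

lemma HasFDerivAt.pd_eq {f' : Euc n →L[ℝ] ℝ} (h : HasFDerivAt f f' x) (i : Fin n) :
    pd i f x = f' (EuclideanSpace.single i 1) := by
  rw [pd, h.fderiv]

lemma pd_add (hf : DifferentiableAt ℝ f x) (hg : DifferentiableAt ℝ g x) (i : Fin n) :
    pd i (fun y => f y + g y) x = pd i f x + pd i g x := by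
  rw [(hf.hasFDerivAt.fun_add hg.hasFDerivAt).pd_eq]; rfl

lemma pd_sub (hf : DifferentiableAt ℝ f x) (hg : DifferentiableAt ℝ g x) (i : Fin n) :
    pd i (fun y => f y - g y) x = pd i f x - pd i g x := by
  rw [(hf.hasFDerivAt.fun_sub hg.hasFDerivAt).pd_eq]; rfl

lemma pd_mul (hf : DifferentiableAt ℝ f x) (hg : DifferentiableAt ℝ g x) (i : Fin n) :
    pd i (fun y => f y * g y) x = f x * pd i g x + pd i f x * g x := by
  rw [(hf.hasFDerivAt.fun_mul hg.hasFDerivAt).pd_eq]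
  simp [pd]; ring

lemma pd_const_mul (c : ℝ) (hf : DifferentiableAt ℝ f x) (i : Fin n) :
    pd i (fun y => c * f y) x = c * pd i f x := by
  rw [(hf.hasFDerivAt.const_mul c).pd_eq]; rfl

lemma pd_sum {ι : Type*} {s : Finset ι} {F : ι → Euc n → ℝ}
    (hF : ∀ k ∈ s, DifferentiableAt ℝ (F k) x) (i : Fin n) :
    pd i (fun y => ∑ k ∈ s, F k y) x = ∑ k ∈ s, pd i (F k) x := by
  rw [(HasFDerivAt.fun_sum fun k hk => (hF k hk).hasFDerivAt).pd_eq]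
  simp [pd]

lemma pd_comp {h : ℝ → ℝ} {h' : ℝ} (hh : HasDerivAt h h' (f x)) (hf : DifferentiableAt ℝ f x)
    (i : Fin n) : pd i (fun y => h (f y)) x = h' * pd i f x := by
  have h1 : HasFDerivAt (fun y => h (f y)) (h' • fderiv ℝ f x) x :=
    hh.comp_hasFDerivAt x hf.hasFDerivAt
  rw [h1.pd_eq]; rfl

lemma pd_comp_affine (f : Euc n → ℝ) (a : Euc n) (t : ℝ) (x : Euc n)
    (hf : DifferentiableAt ℝ f (a + t • x)) (i : Fin n) :
    pd i (fun y => f (a + t • y)) x = t * pd i f (a + t • x) := by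
  have h1 : HasFDerivAt (fun y : Euc n => a + t • y) (t • ContinuousLinearMap.id ℝ (Euc n)) x :=
    ((hasFDerivAt_id x).const_smul t).const_add a
  have h2 := HasFDerivAt.comp x hf.hasFDerivAt h1
  have h3 : pd i (fun y => f (a + t • y)) x =
    ((fderiv ℝ f (a + t • x)).comp (t • ContinuousLinearMap.id ℝ (Euc n)))
      (EuclideanSpace.single i 1) := h2.pd_eq i
  rw [h3]
  simp [pd]

lemma pd_coord (i j : Fin n) (x : Euc n) :
    pd i (fun y : Euc n => y j) x = if j = i then 1 else 0 := by
  have h : HasFDerivAt (fun y : Euc n => y j) (EuclideanSpace.proj (𝕜 := ℝ) j) x :=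
    (EuclideanSpace.proj (𝕜 := ℝ) j).hasFDerivAt
  rw [h.pd_eq]
  simp

lemma contDiff_coord {k : WithTop ℕ∞} (i : Fin n) : ContDiff ℝ k (fun y : Euc n => y i) :=
  (EuclideanSpace.proj (𝕜 := ℝ) i).contDiff

lemma pd_norm_sq (i : Fin n) (x : Euc n) : pd i (fun y : Euc n => ‖y‖ ^ 2) x = 2 * x i := by
  have h : HasFDerivAt (fun y : Euc n => ‖y‖ ^ 2) _ x := (hasStrictFDerivAt_norm_sq x).hasFDerivAt
  rw [h.pd_eq]
  simp [EuclideanSpace.inner_single_right, two_mul]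

lemma elaplacian_norm_sq (x : Euc n) : elaplacian (fun y : Euc n => ‖y‖ ^ 2) x = 2 * n := by
  have h : ∀ i : Fin n, pd i (fun y : Euc n => ‖y‖ ^ 2) = fun y => 2 * y i :=
    fun i => funext (pd_norm_sq i)
  have h2 : ∀ i : Fin n, pd i (fun y : Euc n => 2 * y i) x = 2 := fun i => by
    rw [pd_const_mul 2 ((contDiff_coord (k := 1) i).differentiable (by norm_num) x), pd_coord]
    simp
  simp only [elaplacian_eq_sum_pd, h, h2]
  simp [mul_comm]

end PartialDerivatives

section Averages

variable {n : ℕ}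

/-- A smooth kernel supported in the closed unit ball. -/
structure IsKernel (K : Euc n → ℝ) : Prop where
  smooth : ContDiff ℝ ∞ K
  eq_zero : ∀ y, 1 < ‖y‖ → K y = 0

/-- The average of `f` around `x` at scale `t` with weight `K`. -/
noncomputable def kavg (K f : Euc n → ℝ) (t : ℝ) (x : Euc n) : ℝ :=
  ∫ y, K y * f (x + t • y)

namespace IsKernel

variable {K L : Euc n → ℝ}

lemma continuous (hK : IsKernel K) : Continuous K := hK.smooth.continuous

lemma differentiable (hK : IsKernel K) : Differentiable ℝ K :=
  hK.smooth.differentiable (by norm_num)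

lemma pd (hK : IsKernel K) (i : Fin n) : IsKernel (pd i K) where
  smooth := hK.smooth.pd (by norm_num) i
  eq_zero y hy := by
    have h : K =ᶠ[𝓝 y] fun _ => 0 := by
      filter_upwards [(isOpen_lt continuous_const continuous_norm).mem_nhds hy] with z hz
      exact hK.eq_zero z hz
    rw [pd_congr h, _root_.pd]; simp

lemma coord_mul (hK : IsKernel K) (i : Fin n) : IsKernel (fun y => y i * K y) where
  smooth := (contDiff_coord i).mul hK.smooth
  eq_zero y hy := by simp [hK.eq_zero y hy]

lemma const_mul (hK : IsKernel K) (c : ℝ) : IsKernel (fun y => c * K y) where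
  smooth := contDiff_const.mul hK.smooth
  eq_zero y hy := by simp [hK.eq_zero y hy]

lemma hasCompactSupport (hK : IsKernel K) : HasCompactSupport K :=
  HasCompactSupport.intro (isCompact_closedBall (0 : Euc n) 1) fun y hy =>
    hK.eq_zero y (by simpa using hy)

lemma integrable_mul (hK : IsKernel K) {h : Euc n → ℝ} (hh : Continuous h) :
    Integrable (fun y => K y * h y) :=
  (hK.continuous.mul hh).integrable_of_hasCompactSupport hK.hasCompactSupport.mul_right

lemma integrable (hK : IsKernel K) : Integrable K :=
  hK.continuous.integrable_of_hasCompactSupport hK.hasCompactSupport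

lemma abs_integral_mul_le (hK : IsKernel K) {h : Euc n → ℝ} {M : ℝ}
    (hM : ∀ y, ‖y‖ ≤ 1 → |h y| ≤ M) : |∫ y, K y * h y| ≤ (∫ y, |K y|) * M := by
  rw [← integral_mul_const, ← Real.norm_eq_abs]
  refine norm_integral_le_of_norm_le (hK.integrable.abs.mul_const M) (ae_of_all _ fun y => ?_)
  rw [norm_mul, Real.norm_eq_abs, Real.norm_eq_abs]
  by_cases hy : ‖y‖ ≤ 1
  · exact mul_le_mul_of_nonneg_left (hM y hy) (abs_nonneg _)
  · simp [hK.eq_zero y (not_le.1 hy)]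

end IsKernel

variable {K : Euc n → ℝ} {f g : Euc n → ℝ}

lemma continuous_comp_affine (hf : Continuous f) (x : Euc n) (t : ℝ) :
    Continuous fun y => f (x + t • y) := by fun_prop

lemma abs_kavg_le (hK : IsKernel K) {M t : ℝ} {x : Euc n} (ht : 0 ≤ t)
    (hM : ∀ z, ‖z - x‖ ≤ t → |f z| ≤ M) : |kavg K f t x| ≤ (∫ y, |K y|) * M :=
  hK.abs_integral_mul_le fun y hy => hM _ (by
    rw [add_sub_cancel_left, norm_smul, Real.norm_eq_abs, abs_of_nonneg ht]
    nlinarith)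

lemma abs_kavg_sub_le (hK : IsKernel K) (hf : Continuous f) {M t : ℝ} {x x' : Euc n}
    (hM : ∀ y, ‖y‖ ≤ 1 → |f (x + t • y) - f (x' + t • y)| ≤ M) :
    |kavg K f t x - kavg K f t x'| ≤ (∫ y, |K y|) * M := by
  rw [kavg, kavg, ← integral_sub (hK.integrable_mul (continuous_comp_affine hf x t))
    (hK.integrable_mul (continuous_comp_affine hf x' t))]
  simp only [← mul_sub]
  exact hK.abs_integral_mul_le hM

lemma continuous_kavg (hK : IsKernel K) (hf : Continuous f) (x : Euc n) :
    Continuous fun t => kavg K f t x := by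
  rw [← continuousOn_univ]
  refine continuousOn_integral_of_compact_support (isCompact_closedBall (0 : Euc n) 1) ?_ ?_
  · have := hK.continuous
    simp only [Function.uncurry_def]
    fun_prop
  · intro t y _ hy
    rw [hK.eq_zero y (by simpa using hy), zero_mul]

lemma kavg_zero (K f : Euc n → ℝ) (x : Euc n) : kavg K f 0 x = (∫ y, K y) * f x := by
  simp [kavg, integral_mul_const]

lemma kavg_const (K : Euc n → ℝ) (c t : ℝ) (x : Euc n) :
    kavg K (fun _ => c) t x = (∫ y, K y) * c := by
  simp [kavg, integral_mul_const]

lemma mul_kavg_pd (hK : IsKernel K) (hf : ContDiff ℝ 1 f) (t : ℝ) (x : Euc n) (i : Fin n) :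
    t * kavg K (pd i f) t x = - kavg (pd i K) f t x := by
  have hd : Differentiable ℝ f := hf.differentiable (by norm_num)
  have hg : Differentiable ℝ fun y => f (x + t • y) := by fun_prop
  have h := integral_mul_fderiv_eq_neg_fderiv_mul_of_integrable (μ := volume) (𝕜 := ℝ) (f := K)
    (g := fun y => f (x + t • y)) (v := EuclideanSpace.single i 1)
    ((hK.pd i).integrable_mul (continuous_comp_affine hf.continuous x t))
    (hK.integrable_mul (ContDiff.pd (m := 0) (f := fun y => f (x + t • y)) (k := 1)
      (by fun_prop) (by norm_num) i).continuous)
    (hK.integrable_mul (continuous_comp_affine hf.continuous x t))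
    (fun y _ => hK.differentiable y) (fun y _ => hg y)
  rw [kavg, kavg, ← integral_const_mul]
  refine Eq.trans (integral_congr_ae (ae_of_all _ fun y => ?_)) h
  have := pd_comp_affine f x t y (hd _) i
  simp only [pd] at this ⊢
  rw [this]; ring

lemma kavg_sum {ι : Type*} {s : Finset ι} {F : ι → Euc n → ℝ} (hK : IsKernel K)
    (hF : ∀ k ∈ s, Continuous (F k)) (t : ℝ) (x : Euc n) :
    kavg K (fun y => ∑ k ∈ s, F k y) t x = ∑ k ∈ s, kavg K (F k) t x := by
  simp only [kavg, Finset.mul_sum]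
  exact integral_finsetSum _ fun k hk => hK.integrable_mul (continuous_comp_affine (hF k hk) x t)

lemma kavg_const_mul_kernel (c : ℝ) (K f : Euc n → ℝ) (t : ℝ) (x : Euc n) :
    kavg (fun y => c * K y) f t x = c * kavg K f t x := by
  simp only [kavg, mul_assoc, integral_const_mul]

lemma hasDerivAt_kavg (hK : IsKernel K) (hf : ContDiff ℝ 1 f) (t : ℝ) (x : Euc n) :
    HasDerivAt (fun s => kavg K f s x) (∑ i, kavg (fun y => y i * K y) (pd i f) t x) t := by
  have hfd : Continuous (fderiv ℝ f) := hf.continuous_fderiv (by norm_num)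
  have hd : Differentiable ℝ f := hf.differentiable (by norm_num)
  obtain ⟨M, hM⟩ := ((isCompact_closedBall t 1).prod
    (isCompact_closedBall (0 : Euc n) 1)).exists_bound_of_continuousOn
    (f := fun p : ℝ × Euc n => fderiv ℝ f (x + p.1 • p.2) p.2) (by fun_prop)
  have key := (hasDerivAt_integral_of_dominated_loc_of_deriv_le (μ := (volume : Measure (Euc n)))
    (F := fun s y => K y * f (x + s • y)) (x₀ := t) (s := Metric.closedBall t 1)
    (F' := fun s y => K y * fderiv ℝ f (x + s • y) y) (bound := fun y => |K y| * M)
    (Metric.closedBall_mem_nhds t one_pos)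
    (Eventually.of_forall fun s =>
      (hK.integrable_mul (continuous_comp_affine hf.continuous x s)).aestronglyMeasurable)
    (hK.integrable_mul (continuous_comp_affine hf.continuous x t))
    (hK.integrable_mul (by fun_prop)).aestronglyMeasurable
    (ae_of_all _ fun y s hs => by
      rw [norm_mul, Real.norm_eq_abs]
      by_cases hy : ‖y‖ ≤ 1
      · exact mul_le_mul_of_nonneg_left (hM (s, y) ⟨hs, by simpa using hy⟩) (abs_nonneg _)
      · simp [hK.eq_zero y (not_le.1 hy)])
    (hK.integrable.abs.mul_const M)
    (ae_of_all _ fun y s _ => by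
      have h1 : HasDerivAt (fun s : ℝ => x + s • y) y s := by
        simpa using ((hasDerivAt_id s).smul_const y).const_add x
      exact ((hd _).hasFDerivAt.comp_hasDerivAt s h1).const_mul (K y))).2
  refine key.congr_deriv ?_
  simp only [kavg]
  rw [← integral_finsetSum _ fun i _ => (hK.coord_mul i).integrable_mul
    (continuous_comp_affine (hf.pd (m := 0) (by norm_num) i).continuous x t)]
  refine integral_congr_ae (ae_of_all _ fun y => ?_)
  dsimp only
  rw [fderiv_apply_eq_sum_pd, Finset.mul_sum]
  exact Finset.sum_congr rfl fun i _ => by ring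

end Averages

section KernelPairs

variable {n : ℕ}

/-- A probability kernel `φ` together with `ψ` such that `∇ψ(y) = -φ(y) y`; the pair expresses the
evolution in `t` of the averages at scale `t` through the Laplacian. -/
structure IsKernelPair (φ ψ : Euc n → ℝ) : Prop where
  left : IsKernel φ
  right : IsKernel ψ
  left_nonneg : ∀ y, 0 ≤ φ y
  integral_left : ∫ y, φ y = 1
  right_nonneg : ∀ y, 0 ≤ ψ y
  integral_right : 0 < ∫ y, ψ y
  pd_right : ∀ i y, pd i ψ y = -(y i * φ y)

lemma exists_isKernelPair (hn : 0 < n) : ∃ φ ψ : Euc n → ℝ, IsKernelPair φ ψ := by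
  set ψ : Euc n → ℝ := fun y => expNegInvGlue (1 - ‖y‖ ^ 2) with hψ
  set φ : Euc n → ℝ := fun y => 2 * deriv expNegInvGlue (1 - ‖y‖ ^ 2) with hφ
  have hexp : ContDiff ℝ ∞ expNegInvGlue := expNegInvGlue.contDiff
  have hdexp : ContDiff ℝ ∞ (deriv expNegInvGlue) := by
    have := contDiff_infty_iff_deriv.1 hexp
    exact this.2
  have hsq : ContDiff ℝ ∞ fun y : Euc n => 1 - ‖y‖ ^ 2 := contDiff_const.sub (contDiff_norm_sq ℝ)
  have hψK : IsKernel ψ := ⟨hexp.comp hsq, fun y hy =>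
    expNegInvGlue.zero_of_nonpos (by nlinarith)⟩
  have hφK : IsKernel φ := ⟨contDiff_const.mul (hdexp.comp hsq), fun y hy => by
    have hneg : 1 - ‖y‖ ^ 2 < 0 := by nlinarith
    have : expNegInvGlue =ᶠ[𝓝 (1 - ‖y‖ ^ 2)] fun _ => 0 := by
      filter_upwards [gt_mem_nhds hneg] with z hz
      exact expNegInvGlue.zero_of_nonpos hz.le
    simp [hφ, this.deriv_eq]⟩
  have hpd : ∀ i y, pd i ψ y = -(y i * φ y) := by
    intro i y
    have h1 : HasDerivAt (fun r : ℝ => expNegInvGlue (1 - r))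
        (-deriv expNegInvGlue (1 - ‖y‖ ^ 2)) (‖y‖ ^ 2) := by
      have h2 : HasDerivAt expNegInvGlue (deriv expNegInvGlue (1 - ‖y‖ ^ 2)) (1 - ‖y‖ ^ 2) :=
        (hexp.differentiable (by norm_num) _).hasDerivAt
      simpa using h2.comp_const_sub 1 (‖y‖ ^ 2)
    have h3 := pd_comp (f := fun y : Euc n => ‖y‖ ^ 2) h1
      ((contDiff_norm_sq ℝ (n := 1)).differentiable (by norm_num) y) i
    rw [pd_norm_sq] at h3
    rw [hψ, h3, hφ]; ring
  have hφ0 : ∀ y, 0 ≤ φ y := fun y => mul_nonneg zero_le_two expNegInvGlue.monotone.deriv_nonneg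
  have hψ0 : ∀ y, 0 ≤ ψ y := fun y => expNegInvGlue.nonneg _
  have hψpos : 0 < ψ 0 := expNegInvGlue.pos_of_pos (by simp)
  have hne : ∃ y, φ y ≠ 0 := by
    by_contra! h
    have hfd : ∀ y, fderiv ℝ ψ y = 0 := fun y => by
      ext v
      rw [fderiv_apply_eq_sum_pd]
      simp [hpd, h]
    have hc := is_const_of_fderiv_eq_zero hψK.differentiable hfd 0
      (EuclideanSpace.single ⟨0, hn⟩ 2)
    rw [hψK.eq_zero (EuclideanSpace.single ⟨0, hn⟩ 2) (by simp)] at hc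
    exact hψpos.ne' hc
  obtain ⟨y₀, hy₀⟩ := hne
  have hI : 0 < ∫ y, φ y :=
    hφK.continuous.integral_pos_of_hasCompactSupport_nonneg_nonzero hφK.hasCompactSupport hφ0 hy₀
  have hJ : 0 < ∫ y, ψ y :=
    hψK.continuous.integral_pos_of_hasCompactSupport_nonneg_nonzero hψK.hasCompactSupport hψ0
      hψpos.ne'
  obtain ⟨c, hcpos, hc⟩ : ∃ c : ℝ, 0 < c ∧ c * ∫ y, φ y = 1 :=
    ⟨(∫ y, φ y)⁻¹, inv_pos.2 hI, inv_mul_cancel₀ hI.ne'⟩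
  refine ⟨fun y => c * φ y, fun y => c * ψ y, hφK.const_mul c, hψK.const_mul c,
    fun y => mul_nonneg hcpos.le (hφ0 y), ?_, fun y => mul_nonneg hcpos.le (hψ0 y), ?_, ?_⟩
  · rw [integral_const_mul, hc]
  · rw [integral_const_mul]; exact mul_pos hcpos hJ
  · intro i y
    rw [pd_const_mul c (hψK.differentiable y), hpd]; ring

variable {φ ψ K : Euc n → ℝ} {f g : Euc n → ℝ}

lemma integral_pd_kernel (hK : IsKernel K) (i : Fin n) : ∫ y, pd i K y = 0 := by
  have h := mul_kavg_pd hK (f := fun _ => (1 : ℝ)) contDiff_const 0 0 i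
  simpa [kavg] using h

lemma kavg_pd_swap (hK : IsKernel K) (hf : ContDiff ℝ 1 f) {t : ℝ} (ht : t ≠ 0) (x : Euc n)
    (i j : Fin n) : kavg (pd i K) (pd j f) t x = kavg (pd j K) (pd i f) t x := by
  have h1 := mul_kavg_pd (hK.pd i) hf t x j
  have h2 := mul_kavg_pd (hK.pd j) hf t x i
  have h3 : pd j (pd i K) = pd i (pd j K) :=
    funext fun y => pd_comm (hK.smooth.of_le (by norm_cast)).contDiffAt j i
  rw [h3, ← h2] at h1
  exact mul_left_cancel₀ ht h1

lemma pd_comm_fun (hg : ContDiff ℝ 2 g) (i j : Fin n) : pd i (pd j g) = pd j (pd i g) :=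
  funext fun _ => pd_comm hg.contDiffAt i j

lemma continuous_pd_pd (hg : ContDiff ℝ 2 g) (i j : Fin n) : Continuous (pd i (pd j g)) :=
  ((hg.pd (m := 1) (by norm_num) j).pd (m := 0) (by norm_num) i).continuous

lemma continuous_elaplacian (hg : ContDiff ℝ 2 g) : Continuous (elaplacian g) :=
  continuous_finsetSum _ fun i _ => continuous_pd_pd hg i i

lemma kavg_elaplacian (hK : IsKernel K) (hg : ContDiff ℝ 2 g) (t : ℝ) (x : Euc n) :
    kavg K (elaplacian g) t x = ∑ i, kavg K (pd i (pd i g)) t x :=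
  kavg_sum hK (fun i _ => continuous_pd_pd hg i i) t x

namespace IsKernelPair

lemma coord_mul_left (h : IsKernelPair φ ψ) (i : Fin n) :
    (fun y => y i * φ y) = fun y => (-1) * pd i ψ y :=
  funext fun y => by rw [h.pd_right]; ring

lemma hasDerivAt_kavg (h : IsKernelPair φ ψ) (hg : ContDiff ℝ 2 g) (t : ℝ) (x : Euc n) :
    HasDerivAt (fun s => kavg φ g s x) (t * kavg ψ (elaplacian g) t x) t := by
  refine (_root_.hasDerivAt_kavg h.left (hg.of_le (by norm_num)) t x).congr_deriv ?_
  rw [kavg_elaplacian h.right hg, Finset.mul_sum]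
  refine Finset.sum_congr rfl fun i _ => ?_
  rw [h.coord_mul_left, kavg_const_mul_kernel,
    mul_kavg_pd h.right (hg.pd (by norm_num) i)]
  ring

lemma hasDerivAt_kavg_pd (h : IsKernelPair φ ψ) (hg : ContDiff ℝ 2 g) {t : ℝ} (ht : t ≠ 0)
    (x : Euc n) (j : Fin n) :
    HasDerivAt (fun s => kavg φ (pd j g) s x) (-kavg (pd j ψ) (elaplacian g) t x) t := by
  refine (_root_.hasDerivAt_kavg h.left (hg.pd (by norm_num) j) t x).congr_deriv ?_
  rw [kavg_elaplacian (h.right.pd j) hg, ← Finset.sum_neg_distrib]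
  refine Finset.sum_congr rfl fun i _ => ?_
  rw [h.coord_mul_left, kavg_const_mul_kernel, pd_comm_fun hg i j,
    kavg_pd_swap h.right (hg.pd (by norm_num) i) ht x i j]
  ring

lemma kavg_coord_mul_pd (h : IsKernelPair φ ψ) (hf : ContDiff ℝ 1 f) (t : ℝ) (x : Euc n)
    (j : Fin n) : ∑ i, kavg (fun y => y i * pd j φ y) (pd i f) t x =
      -(∑ i, kavg (pd j (pd i ψ)) (pd i f) t x) - kavg φ (pd j f) t x := by
  have hc : ∀ i, Continuous (pd i f) := fun i => (hf.pd (m := 0) (by norm_num) i).continuous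
  have key : ∀ i, kavg (fun y => y i * pd j φ y) (pd i f) t x =
      -kavg (pd j (pd i ψ)) (pd i f) t x - if i = j then kavg φ (pd i f) t x else 0 := by
    intro i
    have hy : ∀ y, pd j (pd i ψ) y = -(y i * pd j φ y) - if i = j then φ y else 0 := by
      intro y
      have : pd i ψ = fun y => (-1) * (y i * φ y) := funext fun y => by rw [h.pd_right]; ring
      have hd : DifferentiableAt ℝ (fun y : Euc n => y i) y :=
        (contDiff_coord (k := 1) i).differentiable (by norm_num) y
      rw [this, pd_const_mul _ (hd.fun_mul (h.left.differentiable y)),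
        pd_mul hd (h.left.differentiable y), pd_coord]
      split_ifs <;> ring
    have h1 : (fun y => y i * pd j φ y) =
        fun y => (-1) * pd j (pd i ψ) y - if i = j then φ y else 0 :=
      funext fun y => by rw [hy]; ring
    rw [h1]
    split_ifs with hij
    · simp only [kavg, sub_mul]
      rw [integral_sub ((((h.right.pd i).pd j).const_mul (-1)).integrable_mul
        (continuous_comp_affine (hc i) x t))
        (h.left.integrable_mul (continuous_comp_affine (hc i) x t))]
      simp [integral_neg]
    · simp [kavg, integral_neg]
  simp only [key, Finset.sum_sub_distrib, Finset.sum_neg_distrib, Finset.sum_ite_eq',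
    Finset.mem_univ, if_true]

lemma hasDerivAt_kavg_pd_pd (h : IsKernelPair φ ψ) (hg : ContDiff ℝ 2 g) {t : ℝ} (ht : t ≠ 0)
    (x : Euc n) (j k : Fin n) :
    HasDerivAt (fun s => kavg φ (pd j (pd k g)) s x)
      (t⁻¹ * kavg (pd k (pd j ψ)) (elaplacian g) t x) t := by
  have hf : ContDiff ℝ 1 (pd k g) := hg.pd (by norm_num) k
  have hev : (fun s => kavg φ (pd j (pd k g)) s x) =ᶠ[𝓝 t]
      fun s => -(s⁻¹ * kavg (pd j φ) (pd k g) s x) := by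
    filter_upwards [isOpen_ne.mem_nhds ht] with s hs
    have := mul_kavg_pd h.left hf s x j
    rw [← mul_neg, ← this, inv_mul_cancel_left₀ hs]
  have hd := ((hasDerivAt_inv ht).mul (_root_.hasDerivAt_kavg (h.left.pd j) hf t x)).neg
  refine (hd.congr_of_eventuallyEq hev).congr_deriv ?_
  rw [h.kavg_coord_mul_pd hf, kavg_elaplacian ((h.right.pd j).pd k) hg]
  have h1 := mul_kavg_pd h.left hf t x j
  have h2 : ∀ i, kavg (pd j (pd i ψ)) (pd i (pd k g)) t x =
      kavg (pd k (pd j ψ)) (pd i (pd i g)) t x := by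
    intro i
    have hψ2 : ContDiff ℝ 2 ψ := h.right.smooth.of_le (by norm_cast)
    rw [pd_comm_fun hψ2 j i, pd_comm_fun hg i k,
      kavg_pd_swap (h.right.pd j) (hg.pd (by norm_num) i) ht x i k]
  simp only [h2]
  have h3 : kavg (pd j φ) (pd k g) t x = -(t * kavg φ (pd j (pd k g)) t x) := by
    rw [h1, neg_neg]
  rw [h3]
  field_simp
  ring

end IsKernelPair

end KernelPairs

section InteriorEstimates

variable {n : ℕ} {φ ψ : Euc n → ℝ} {g : Euc n → ℝ}

lemma abs_sub_le_of_fderiv_le {s : Set (Euc n)} (hs : Convex ℝ s) (hg : Differentiable ℝ g) {M : ℝ}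
    (hM : ∀ z ∈ s, ‖fderiv ℝ g z‖ ≤ M) {x x' : Euc n} (hx : x ∈ s) (hx' : x' ∈ s) :
    |g x - g x'| ≤ M * ‖x - x'‖ :=
  hs.norm_image_sub_le_of_norm_fderiv_le (fun z _ => hg z) hM hx' hx

lemma add_smul_mem_ball {ρ t : ℝ} {x y : Euc n} (hx : x ∈ Metric.ball (0 : Euc n) ρ)
    (ht : 0 ≤ t) (ht1 : t ≤ 1) (hy : ‖y‖ ≤ 1) : x + t • y ∈ Metric.ball (0 : Euc n) (ρ + 1) := by
  rw [mem_ball_zero_iff] at *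
  have h1 : ‖t • y‖ ≤ 1 := by
    rw [norm_smul, Real.norm_eq_abs, abs_of_nonneg ht]; nlinarith [norm_nonneg y]
  linarith [norm_add_le x (t • y)]

lemma mem_ball_of_norm_sub_le {ρ t : ℝ} {x z : Euc n} (hx : x ∈ Metric.ball (0 : Euc n) ρ)
    (ht1 : t ≤ 1) (hz : ‖z - x‖ ≤ t) : z ∈ Metric.ball (0 : Euc n) (ρ + 1) := by
  rw [mem_ball_zero_iff] at *
  have := norm_add_le x (z - x)
  rw [add_sub_cancel] at this
  linarith

namespace IsKernelPair

lemma kavg_left_zero (h : IsKernelPair φ ψ) (f : Euc n → ℝ) (x : Euc n) :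
    kavg φ f 0 x = f x := by
  rw [kavg_zero, h.integral_left, one_mul]

lemma abs_kavg_pd_sub_le (h : IsKernelPair φ ψ) (hg : ContDiff ℝ 2 g) {t M : ℝ} (ht : 0 < t)
    {x : Euc n} (hM : ∀ z, ‖z - x‖ ≤ t → |elaplacian g z| ≤ M) (j : Fin n) :
    |kavg φ (pd j g) t x - pd j g x| ≤ t * ((∫ y, |pd j ψ y|) * M) := by
  have hc : Continuous (pd j g) := (hg.pd (m := 1) (by norm_num) j).continuous
  obtain ⟨c, hc, hslope⟩ := exists_hasDerivAt_eq_slope (fun s => kavg φ (pd j g) s x)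
    (fun s => -kavg (pd j ψ) (elaplacian g) s x) ht
    (continuous_kavg h.left hc x).continuousOn
    (fun s hs => h.hasDerivAt_kavg_pd hg hs.1.ne' x j)
  rw [h.kavg_left_zero, sub_zero, eq_div_iff ht.ne'] at hslope
  rw [← hslope, abs_mul, abs_neg, abs_of_pos ht, mul_comm]
  refine mul_le_mul_of_nonneg_left ?_ ht.le
  exact abs_kavg_le (h.right.pd j) hc.1.le fun z hz => hM z (hz.trans hc.2.le)

/-- Interior estimate for the oscillation of the first derivatives. -/
lemma abs_pd_sub_le (h : IsKernelPair φ ψ) (hg : ContDiff ℝ 2 g) {ρ M B t : ℝ}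
    (hM : ∀ z ∈ Metric.ball (0 : Euc n) (ρ + 1), ‖fderiv ℝ g z‖ ≤ M)
    (hB : ∀ z ∈ Metric.ball (0 : Euc n) (ρ + 1), |elaplacian g z| ≤ B) (ht : 0 < t) (ht1 : t ≤ 1)
    {x x' : Euc n} (hx : x ∈ Metric.ball (0 : Euc n) ρ) (hx' : x' ∈ Metric.ball (0 : Euc n) ρ)
    (j : Fin n) :
    |pd j g x - pd j g x'| ≤
      2 * (t * ((∫ y, |pd j ψ y|) * B)) + t⁻¹ * ((∫ y, |pd j φ y|) * (M * ‖x - x'‖)) := by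
  have h1 := h.abs_kavg_pd_sub_le hg ht (fun z hz => hB z (mem_ball_of_norm_sub_le hx ht1 hz)) j
  have h2 := h.abs_kavg_pd_sub_le hg ht (fun z hz => hB z (mem_ball_of_norm_sub_le hx' ht1 hz)) j
  have h3 : ∀ z, kavg φ (pd j g) t z = -(t⁻¹ * kavg (pd j φ) g t z) := fun z => by
    rw [← mul_neg, ← mul_kavg_pd h.left (hg.of_le (by norm_num)) t z j,
      inv_mul_cancel_left₀ ht.ne']
  have h4 : |kavg φ (pd j g) t x - kavg φ (pd j g) t x'| ≤
      t⁻¹ * ((∫ y, |pd j φ y|) * (M * ‖x - x'‖)) := by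
    rw [h3, h3, show -(t⁻¹ * kavg (pd j φ) g t x) - -(t⁻¹ * kavg (pd j φ) g t x') =
      -(t⁻¹ * (kavg (pd j φ) g t x - kavg (pd j φ) g t x')) by ring, abs_neg, abs_mul,
      abs_of_pos (inv_pos.2 ht)]
    refine mul_le_mul_of_nonneg_left ?_ (inv_pos.2 ht).le
    refine abs_kavg_sub_le (h.left.pd j) hg.continuous fun y hy => ?_
    have := abs_sub_le_of_fderiv_le (convex_ball _ _) (hg.differentiable (by norm_num)) hM
      (add_smul_mem_ball hx ht.le ht1 hy) (add_smul_mem_ball hx' ht.le ht1 hy)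
    rwa [add_sub_add_right_eq_sub] at this
  rw [abs_le] at *
  constructor <;> linarith [h1.1, h1.2, h2.1, h2.2, h4.1, h4.2]

lemma abs_kavg_pd_pd_sub_le (h : IsKernelPair φ ψ) (hg : ContDiff ℝ 2 g) {t H α : ℝ} (ht : 0 < t)
    (hα : 0 < α) {x : Euc n} (hH0 : 0 ≤ H)
    (hH : ∀ z, ‖z - x‖ ≤ t → |elaplacian g z - elaplacian g x| ≤ H * ‖z - x‖ ^ α) (j k : Fin n) :
    |kavg φ (pd j (pd k g)) t x - pd j (pd k g) x| ≤
      (∫ y, |pd k (pd j ψ) y|) * (H * (t ^ α / α)) := by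
  set A := ∫ y, |pd k (pd j ψ) y| with hA
  have hA0 : 0 ≤ A := integral_nonneg fun y => abs_nonneg _
  have hK := (h.right.pd j).pd k
  obtain ⟨c, hc, hslope⟩ := exists_ratio_hasDerivAt_eq_ratio_slope
    (fun s => kavg φ (pd j (pd k g)) s x)
    (fun s => s⁻¹ * kavg (pd k (pd j ψ)) (elaplacian g) s x) ht
    (continuous_kavg h.left (continuous_pd_pd hg j k) x).continuousOn
    (fun s hs => h.hasDerivAt_kavg_pd_pd hg hs.1.ne' x j k)
    (fun s => s ^ α / α) (fun s => s ^ (α - 1))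
    ((continuous_id.rpow_const fun _ => Or.inr hα.le).div_const α).continuousOn
    (fun s hs => by
      have := (Real.hasDerivAt_rpow_const (x := s) (p := α) (Or.inl hs.1.ne')).div_const α
      rwa [mul_div_cancel_left₀ _ hα.ne'] at this)
  simp only [h.kavg_left_zero, Real.zero_rpow hα.ne', zero_div, sub_zero] at hslope
  have hcpos : 0 < c ^ (α - 1) := Real.rpow_pos_of_pos hc.1 _
  have hbound : |kavg (pd k (pd j ψ)) (elaplacian g) c x| ≤ A * (H * c ^ α) := by
    have h1 : kavg (pd k (pd j ψ)) (elaplacian g) c x =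
        kavg (pd k (pd j ψ)) (fun z => elaplacian g z - elaplacian g x) c x := by
      simp only [kavg, mul_sub]
      rw [integral_sub (hK.integrable_mul (continuous_comp_affine (continuous_elaplacian hg) x c))
        (hK.integrable_mul continuous_const), integral_mul_const,
        integral_pd_kernel (h.right.pd j)]
      simp
    rw [h1]
    refine abs_kavg_le hK hc.1.le fun z hz => (hH z (hz.trans hc.2.le)).trans ?_
    exact mul_le_mul_of_nonneg_left (Real.rpow_le_rpow (norm_nonneg _) hz hα.le) hH0
  have h2 : |kavg φ (pd j (pd k g)) t x - pd j (pd k g) x| * c ^ (α - 1) ≤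
      A * (H * (t ^ α / α)) * c ^ (α - 1) := by
    rw [← abs_of_pos hcpos, ← abs_mul, ← hslope, abs_of_pos hcpos, abs_mul, abs_mul,
      abs_of_nonneg (div_nonneg (Real.rpow_nonneg ht.le α) hα.le), abs_of_pos (inv_pos.2 hc.1)]
    have h3 : t ^ α / α * (c⁻¹ * |kavg (pd k (pd j ψ)) (elaplacian g) c x|) ≤
        t ^ α / α * (c⁻¹ * (A * (H * c ^ α))) := by
      have := hc.1
      gcongr
    refine h3.trans (le_of_eq ?_)
    rw [Real.rpow_sub_one hc.1.ne']
    field_simp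
  exact le_of_mul_le_mul_right h2 hcpos

/-- Interior estimate for the oscillation of the second derivatives. -/
lemma abs_pd_pd_sub_le (h : IsKernelPair φ ψ) (hg : ContDiff ℝ 2 g) {ρ M H α t : ℝ} (hα : 0 < α)
    (hH0 : 0 ≤ H) (hM : ∀ z ∈ Metric.ball (0 : Euc n) (ρ + 1), ‖fderiv ℝ g z‖ ≤ M)
    (hH : ∀ z ∈ Metric.ball (0 : Euc n) (ρ + 1), ∀ z' ∈ Metric.ball (0 : Euc n) (ρ + 1),
      ‖z - z'‖ ≤ 1 → |elaplacian g z - elaplacian g z'| ≤ H * ‖z - z'‖ ^ α)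
    (ht : 0 < t) (ht1 : t ≤ 1)
    {x x' : Euc n} (hx : x ∈ Metric.ball (0 : Euc n) ρ) (hx' : x' ∈ Metric.ball (0 : Euc n) ρ)
    (j k : Fin n) :
    |pd j (pd k g) x - pd j (pd k g) x'| ≤
      2 * ((∫ y, |pd k (pd j ψ) y|) * (H * (t ^ α / α))) +
        (t⁻¹ * t⁻¹) * ((∫ y, |pd k (pd j φ) y|) * (M * ‖x - x'‖)) := by
  have hsub : ∀ w ∈ Metric.ball (0 : Euc n) ρ, w ∈ Metric.ball (0 : Euc n) (ρ + 1) :=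
    fun w hw => Metric.ball_subset_ball (by linarith) hw
  have h12 : ∀ w ∈ Metric.ball (0 : Euc n) ρ, _ := fun w hw =>
    h.abs_kavg_pd_pd_sub_le hg ht hα hH0 (fun z hz => hH z (mem_ball_of_norm_sub_le hw ht1 hz)
      w (hsub w hw) (hz.trans ht1)) j k
  have h1 := h12 x hx
  have h2 := h12 x' hx'
  have h3 : ∀ z, kavg φ (pd j (pd k g)) t z = t⁻¹ * t⁻¹ * kavg (pd k (pd j φ)) g t z := fun z => by
    have e1 := mul_kavg_pd h.left (hg.pd (m := 1) (by norm_num) k) t z j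
    have e2 := mul_kavg_pd (h.left.pd j) (hg.of_le (by norm_num)) t z k
    have e3 : kavg (pd k (pd j φ)) g t z = t * (t * kavg φ (pd j (pd k g)) t z) := by
      rw [e1]; linarith
    rw [e3]; field_simp
  have h4 : |kavg φ (pd j (pd k g)) t x - kavg φ (pd j (pd k g)) t x'| ≤
      t⁻¹ * t⁻¹ * ((∫ y, |pd k (pd j φ) y|) * (M * ‖x - x'‖)) := by
    have htt : 0 < t⁻¹ * t⁻¹ := by positivity
    rw [h3, h3, ← mul_sub, abs_mul, abs_of_pos htt]
    refine mul_le_mul_of_nonneg_left ?_ htt.le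
    refine abs_kavg_sub_le ((h.left.pd j).pd k) hg.continuous fun y hy => ?_
    have := abs_sub_le_of_fderiv_le (convex_ball _ _) (hg.differentiable (by norm_num)) hM
      (add_smul_mem_ball hx ht.le ht1 hy) (add_smul_mem_ball hx' ht.le ht1 hy)
    rwa [add_sub_add_right_eq_sub] at this
  rw [abs_le] at *
  constructor <;> linarith [h1.1, h1.2, h2.1, h2.2, h4.1, h4.2]

/-- Interior bound for the second derivatives. -/
lemma abs_pd_pd_le (h : IsKernelPair φ ψ) (hg : ContDiff ℝ 2 g) {ρ M H α : ℝ} (hα : 0 < α)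
    (hH0 : 0 ≤ H) (hM : ∀ z ∈ Metric.ball (0 : Euc n) (ρ + 1), ‖fderiv ℝ g z‖ ≤ M)
    (hH : ∀ z ∈ Metric.ball (0 : Euc n) (ρ + 1), ∀ z' ∈ Metric.ball (0 : Euc n) (ρ + 1),
      ‖z - z'‖ ≤ 1 → |elaplacian g z - elaplacian g z'| ≤ H * ‖z - z'‖ ^ α)
    {x : Euc n} (hx : x ∈ Metric.ball (0 : Euc n) ρ) (j k : Fin n) :
    |pd j (pd k g) x| ≤
      (∫ y, |pd k (pd j ψ) y|) * (H * (1 / α)) + (∫ y, |pd j φ y|) * M := by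
  have h1 := h.abs_kavg_pd_pd_sub_le hg one_pos hα hH0 (fun z hz =>
    hH z (mem_ball_of_norm_sub_le hx le_rfl hz) x (Metric.ball_subset_ball (by linarith) hx) hz) j k
  have h2 := mul_kavg_pd h.left (hg.pd (m := 1) (by norm_num) k) 1 x j
  have h3 : |kavg (pd j φ) (pd k g) 1 x| ≤ (∫ y, |pd j φ y|) * M :=
    abs_kavg_le (h.left.pd j) zero_le_one fun z hz =>
      (abs_pd_le g z k).trans (hM z (mem_ball_of_norm_sub_le hx le_rfl hz))
  rw [one_mul] at h2
  rw [h2, Real.one_rpow] at h1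
  rw [abs_le] at *
  constructor <;> linarith [h1.1, h1.2, h3.1, h3.2]

end IsKernelPair

end InteriorEstimates

section Bernstein

variable {n : ℕ}

lemma pd_comp_add (f : Euc n → ℝ) (a x : Euc n) (i : Fin n) :
    pd i (fun y => f (y + a)) x = pd i f (x + a) := by
  rw [pd, pd, fderiv_comp_add_right]

lemma elaplacian_comp_add (f : Euc n → ℝ) (a x : Euc n) :
    elaplacian (fun y => f (y + a)) x = elaplacian f (x + a) :=
  Finset.sum_congr rfl fun i _ => by
    have h : pd i (fun y => f (y + a)) = fun y => pd i f (y + a) :=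
      funext fun y => pd_comp_add f a y i
    change pd i (pd i fun y => f (y + a)) x = pd i (pd i f) (x + a)
    rw [h, pd_comp_add]

section Algebra

variable {f g : Euc n → ℝ}

lemma differentiable_of_contDiff_two (hf : ContDiff ℝ 2 f) : Differentiable ℝ f :=
  hf.differentiable (by norm_num)

lemma differentiable_pd (hf : ContDiff ℝ 2 f) (i : Fin n) : Differentiable ℝ (pd i f) :=
  (hf.pd (m := 1) (by norm_num) i).differentiable (by norm_num)

lemma elaplacian_sub (hf : ContDiff ℝ 2 f) (hg : ContDiff ℝ 2 g) (x : Euc n) :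
    elaplacian (fun y => f y - g y) x = elaplacian f x - elaplacian g x := by
  simp only [elaplacian_eq_sum_pd, ← Finset.sum_sub_distrib]
  refine Finset.sum_congr rfl fun i _ => ?_
  rw [funext fun y => pd_sub (differentiable_of_contDiff_two hf y)
    (differentiable_of_contDiff_two hg y) i,
    pd_sub (differentiable_pd hf i x) (differentiable_pd hg i x)]

lemma elaplacian_const_mul (c : ℝ) (hf : ContDiff ℝ 2 f) (x : Euc n) :
    elaplacian (fun y => c * f y) x = c * elaplacian f x := by
  simp only [elaplacian_eq_sum_pd, Finset.mul_sum]
  refine Finset.sum_congr rfl fun i _ => ?_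
  rw [funext fun y => pd_const_mul c (differentiable_of_contDiff_two hf y) i,
    pd_const_mul c (differentiable_pd hf i x)]

lemma elaplacian_sum {ι : Type*} {s : Finset ι} {F : ι → Euc n → ℝ}
    (hF : ∀ k ∈ s, ContDiff ℝ 2 (F k)) (x : Euc n) :
    elaplacian (fun y => ∑ k ∈ s, F k y) x = ∑ k ∈ s, elaplacian (F k) x := by
  simp only [elaplacian_eq_sum_pd]
  rw [Finset.sum_comm]
  refine Finset.sum_congr rfl fun i _ => ?_
  rw [funext fun y => pd_sum (fun k hk => differentiable_of_contDiff_two (hF k hk) y) i,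
    pd_sum fun k hk => differentiable_pd (hF k hk) i x]

lemma elaplacian_sq (hf : ContDiff ℝ 2 f) (x : Euc n) :
    elaplacian (fun y => f y ^ 2) x = 2 * ∑ i, pd i f x ^ 2 + 2 * (f x * elaplacian f x) := by
  simp only [elaplacian_eq_sum_pd, Finset.mul_sum, ← Finset.sum_add_distrib]
  refine Finset.sum_congr rfl fun i _ => ?_
  have hd := differentiable_of_contDiff_two hf
  have h1 : pd i (fun y => f y ^ 2) = fun y => 2 * (f y * pd i f y) := funext fun y => by
    simp only [sq]
    rw [pd_mul (hd y) (hd y)]; ring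
  rw [h1, pd_const_mul 2 ((hd x).fun_mul (differentiable_pd hf i x)),
    pd_mul (hd x) (differentiable_pd hf i x)]
  ring

end Algebra

/-- The difference quotient in the `i`-th direction. -/
noncomputable def diffQuot (s : ℝ) (i : Fin n) (f : Euc n → ℝ) (x : Euc n) : ℝ :=
  s⁻¹ * (f (x + s • EuclideanSpace.single i 1) - f x)

lemma contDiff_diffQuot {f : Euc n → ℝ} (hf : ContDiff ℝ 2 f) (s : ℝ) (i : Fin n) :
    ContDiff ℝ 2 (diffQuot s i f) := by
  unfold diffQuot; fun_prop

lemma pd_diffQuot {f : Euc n → ℝ} (hf : Differentiable ℝ f) (s : ℝ) (i j : Fin n) (x : Euc n) :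
    pd j (diffQuot s i f) x = diffQuot s i (pd j f) x := by
  have h : Differentiable ℝ fun y => f (y + s • EuclideanSpace.single i 1) := by fun_prop
  unfold diffQuot
  rw [pd_const_mul _ ((h x).fun_sub (hf x)), pd_sub (h x) (hf x), pd_comp_add]

lemma elaplacian_diffQuot {f : Euc n → ℝ} (hf : ContDiff ℝ 2 f) (s : ℝ) (i : Fin n) (x : Euc n) :
    elaplacian (diffQuot s i f) x = diffQuot s i (elaplacian f) x := by
  have h : ContDiff ℝ 2 fun y => f (y + s • EuclideanSpace.single i 1) := by fun_prop
  unfold diffQuot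
  rw [elaplacian_const_mul _ (h.sub hf), elaplacian_sub h hf, elaplacian_comp_add]

lemma tendsto_diffQuot {f : Euc n → ℝ} {x : Euc n} (hf : ContDiffAt ℝ 1 f x) (i : Fin n) :
    Tendsto (fun p : ℝ × Euc n => diffQuot p.1 i f p.2) (𝓝[≠] 0 ×ˢ 𝓝 x) (𝓝 (pd i f x)) := by
  set e : Euc n := EuclideanSpace.single i 1 with he
  have h := (hf.hasStrictFDerivAt one_ne_zero).isLittleO
  have hmap : Tendsto (fun p : ℝ × Euc n => (p.2 + p.1 • e, p.2)) (𝓝[≠] 0 ×ˢ 𝓝 x)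
      (𝓝 (x, x)) := by
    have hc : Continuous (fun p : ℝ × Euc n => (p.2 + p.1 • e, p.2)) := by fun_prop
    have h0 := hc.tendsto ((0 : ℝ), x)
    simp only [zero_smul, add_zero] at h0
    refine h0.mono_left ?_
    rw [nhds_prod_eq]
    exact Filter.prod_mono nhdsWithin_le_nhds le_rfl
  have h2 := (h.comp_tendsto hmap)
  rw [Metric.tendsto_nhds]
  intro ε hε
  have h3 := h2.bound (half_pos hε)
  have hne : ∀ᶠ p : ℝ × Euc n in 𝓝[≠] 0 ×ˢ 𝓝 x, p.1 ≠ 0 :=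
    (eventually_mem_nhdsWithin (a := (0 : ℝ)) (s := {0}ᶜ)).prod_inl (𝓝 x)
  filter_upwards [h3, hne] with p hp hp0
  simp only [Function.comp_apply, add_sub_cancel_left, map_smul, smul_eq_mul, norm_smul] at hp
  have hee : ‖e‖ = 1 := by simp [he]
  have hpd : fderiv ℝ f x e = pd i f x := rfl
  rw [hee, mul_one, hpd] at hp
  rw [Real.dist_eq, diffQuot, ← he]
  have hpos : 0 < |p.1| := abs_pos.2 hp0
  have h4 : p.1⁻¹ * (f (p.2 + p.1 • e) - f p.2) - pd i f x =
      p.1⁻¹ * (f (p.2 + p.1 • e) - f p.2 - p.1 * pd i f x) := by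
    field_simp
  rw [h4, abs_mul, abs_inv]
  rw [Real.norm_eq_abs, Real.norm_eq_abs] at hp
  calc |p.1|⁻¹ * |f (p.2 + p.1 • e) - f p.2 - p.1 * pd i f x|
      ≤ |p.1|⁻¹ * (ε / 2 * |p.1|) := by gcongr
    _ = ε / 2 := by field_simp
    _ < ε := half_lt_self hε

namespace IsKernelPair

variable {φ ψ : Euc n → ℝ}

lemma le_kavg_sub (h : IsKernelPair φ ψ) {g : Euc n → ℝ} (hg : ContDiff ℝ 2 g) {κ r : ℝ}
    (hr : 0 < r) {x : Euc n} (hκ : ∀ z, ‖z - x‖ ≤ r → κ ≤ elaplacian g z) :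
    κ * (∫ y, ψ y) * r ^ 2 / 2 ≤ kavg φ g r x - g x := by
  obtain ⟨c, hc, hslope⟩ := exists_ratio_hasDerivAt_eq_ratio_slope
    (fun s => kavg φ g s x) (fun s => s * kavg ψ (elaplacian g) s x) hr
    (continuous_kavg h.left hg.continuous x).continuousOn
    (fun s hs => h.hasDerivAt_kavg hg s x)
    (fun s => s ^ 2 / 2) (fun s => s) (by fun_prop)
    (fun s hs => by simpa using (hasDerivAt_pow 2 s).div_const 2)
  simp only [h.kavg_left_zero] at hslope
  have h1 : κ * ∫ y, ψ y ≤ kavg ψ (elaplacian g) c x := by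
    rw [mul_comm, ← kavg_const ψ κ c x]
    refine integral_mono (h.right.integrable_mul continuous_const)
      (h.right.integrable_mul (continuous_comp_affine (continuous_elaplacian hg) x c)) fun y => ?_
    by_cases hy : ‖y‖ ≤ 1
    · refine mul_le_mul_of_nonneg_left (hκ _ ?_) (h.right_nonneg y)
      rw [add_sub_cancel_left, norm_smul, Real.norm_eq_abs, abs_of_pos hc.1]
      nlinarith [hc.1, hc.2, norm_nonneg y]
    · simp [h.right.eq_zero y (not_le.1 hy)]
  have h2 : (r ^ 2 / 2) * (c * kavg ψ (elaplacian g) c x) =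
      (kavg φ g r x - g x) * c := by rw [← hslope]; ring
  have h3 : (r ^ 2 / 2) * kavg ψ (elaplacian g) c x = kavg φ g r x - g x :=
    mul_right_cancel₀ hc.1.ne' (by linarith)
  rw [← h3]
  nlinarith [mul_le_mul_of_nonneg_left h1 (by positivity : 0 ≤ r ^ 2 / 2)]

lemma kavg_le_of_forall_le (h : IsKernelPair φ ψ) {g : Euc n → ℝ} (hg : Continuous g) {m r : ℝ}
    (hr : 0 ≤ r) {x : Euc n} (hm : ∀ z, ‖z - x‖ ≤ r → g z ≤ m) : kavg φ g r x ≤ m := by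
  have h1 : m = kavg φ (fun _ => m) r x := by rw [kavg_const, h.integral_left, one_mul]
  rw [h1]
  refine integral_mono (h.left.integrable_mul (continuous_comp_affine hg x r))
    (h.left.integrable_mul continuous_const) fun y => ?_
  by_cases hy : ‖y‖ ≤ 1
  · refine mul_le_mul_of_nonneg_left (hm _ ?_) (h.left_nonneg y)
    rw [add_sub_cancel_left, norm_smul, Real.norm_eq_abs, abs_of_nonneg hr]
    nlinarith [norm_nonneg y]
  · simp [h.left.eq_zero y (not_le.1 hy)]

end IsKernelPair

lemma tendsto_kavg_sum_diffQuot_sq {φ : Euc n → ℝ} (hφ : IsKernel φ) {w : Euc n → ℝ}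
    (hw : ContDiff ℝ 2 w) (r : ℝ) (x : Euc n) :
    Tendsto (fun s => kavg φ (fun y => ∑ i, diffQuot s i w y ^ 2) r x) (𝓝[≠] 0)
      (𝓝 (kavg φ (fun y => ∑ i, pd i w y ^ 2) r x)) := by
  obtain ⟨M, hM⟩ := (isCompact_closedBall x (|r| + 1)).exists_bound_of_continuousOn
    (hw.continuous_fderiv (by norm_num)).continuousOn
  have hcont : ∀ s, Continuous fun y => ∑ i, diffQuot s i w y ^ 2 := fun s =>
    continuous_finsetSum _ fun i _ => (contDiff_diffQuot hw s i).continuous.pow 2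
  refine tendsto_integral_filter_of_dominated_convergence
    (fun y => |φ y| * ∑ _i : Fin n, M ^ 2) ?_ ?_ (hφ.integrable.abs.mul_const _) ?_
  · exact Eventually.of_forall fun s =>
      (hφ.integrable_mul (continuous_comp_affine (hcont s) x r)).aestronglyMeasurable
  · have hs : ∀ᶠ s : ℝ in 𝓝[≠] 0, |s| < 1 :=
      nhdsWithin_le_nhds ((continuous_abs.tendsto (0 : ℝ)).eventually_lt_const (by simp))
    filter_upwards [hs, self_mem_nhdsWithin] with s hs hs0
    refine ae_of_all _ fun y => ?_
    rw [norm_mul, Real.norm_eq_abs]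
    by_cases hy : ‖y‖ ≤ 1
    · refine mul_le_mul_of_nonneg_left ?_ (abs_nonneg _)
      rw [Real.norm_eq_abs, abs_of_nonneg (Finset.sum_nonneg fun i _ => sq_nonneg _)]
      refine Finset.sum_le_sum fun i _ => ?_
      rw [← sq_abs (diffQuot _ _ _ _)]
      refine pow_le_pow_left₀ (abs_nonneg _) ?_ 2
      have hry : ‖r • y‖ ≤ |r| := by
        rw [norm_smul, Real.norm_eq_abs]; nlinarith [abs_nonneg r, norm_nonneg y]
      have h1 : x + r • y ∈ Metric.closedBall x (|r| + 1) := by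
        rw [mem_closedBall_iff_norm, add_sub_cancel_left]; linarith
      have hse : ‖s • (EuclideanSpace.single i 1 : Euc n)‖ = |s| := by simp [norm_smul]
      have h2 : x + r • y + s • EuclideanSpace.single i 1 ∈ Metric.closedBall x (|r| + 1) := by
        rw [mem_closedBall_iff_norm, add_assoc, add_sub_cancel_left]
        linarith [norm_add_le (r • y) (s • (EuclideanSpace.single i 1 : Euc n))]
      have h3 := abs_sub_le_of_fderiv_le (convex_closedBall _ _)
        (differentiable_of_contDiff_two hw) hM h2 h1
      rw [add_sub_cancel_left, hse] at h3
      have hspos : 0 < |s| := abs_pos.2 hs0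
      rw [diffQuot, abs_mul, abs_inv, inv_mul_le_iff₀ hspos]
      linarith
    · simp [hφ.eq_zero y (not_le.1 hy)]
  · refine ae_of_all _ fun y => Tendsto.const_mul _ (tendsto_finsetSum _ fun i _ => ?_)
    refine Tendsto.pow ?_ 2
    have := tendsto_diffQuot (hw.of_le (m := 1) (by norm_num)).contDiffAt
      (x := x + r • y) i
    exact this.comp (tendsto_id.prodMk (tendsto_const_nhds (x := x + r • y)))

/-- Bernstein's inequality in the viscosity sense: no third derivatives of `w` are needed. -/
lemma bernstein_of_isLocalMax (hn : 0 < n) {w F η : Euc n → ℝ} {x : Euc n} (hw : ContDiff ℝ 2 w)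
    (hF : ContDiffAt ℝ 1 F x) (hη : ContDiff ℝ 2 η) (hwF : elaplacian w =ᶠ[𝓝 x] fun y => -F y)
    (hmax : IsLocalMax (fun y => ∑ i, pd i w y ^ 2 - η y) x) :
    (elaplacian w x) ^ 2 ≤ n * (∑ i, pd i w x * pd i F x + elaplacian η x / 2) := by
  obtain ⟨φ, ψ, h⟩ := exists_isKernelPair hn
  set Q := ∑ i, ∑ j, pd i (pd j w) x ^ 2 with hQ
  have hcs : (elaplacian w x) ^ 2 ≤ n * Q := by
    have h1 := sq_sum_le_card_mul_sum_sq (s := Finset.univ) (f := fun i : Fin n => pd i (pd i w) x)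
    rw [Finset.card_univ, Fintype.card_fin] at h1
    refine h1.trans (mul_le_mul_of_nonneg_left (Finset.sum_le_sum fun i _ => ?_) (by positivity))
    exact Finset.single_le_sum (f := fun j => pd i (pd j w) x ^ 2) (fun j _ => sq_nonneg _)
      (Finset.mem_univ i)
  refine hcs.trans (mul_le_mul_of_nonneg_left ?_ (by positivity))
  by_contra! hlt
  set g : ℝ → Euc n → ℝ := fun s y => ∑ i, diffQuot s i w y ^ 2 - η y with hg
  have hZ : ∀ s i, ContDiff ℝ 2 fun y => diffQuot s i w y ^ 2 := fun s i =>
    (contDiff_diffQuot hw s i).pow 2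
  have hZs : ∀ s, ContDiff ℝ 2 fun y => ∑ i, diffQuot s i w y ^ 2 := fun s =>
    ContDiff.sum fun i _ => hZ s i
  have hgC : ∀ s, ContDiff ℝ 2 (g s) := fun s => (hZs s).sub hη
  have hlap : ∀ s y, elaplacian (g s) y = ∑ i, (2 * ∑ j, diffQuot s i (pd j w) y ^ 2 +
      2 * (diffQuot s i w y * diffQuot s i (elaplacian w) y)) - elaplacian η y := by
    intro s y
    rw [hg]
    simp only
    rw [elaplacian_sub (hZs s) hη, elaplacian_sum fun i _ => hZ s i]
    congr 1
    refine Finset.sum_congr rfl fun i _ => ?_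
    rw [elaplacian_sq (contDiff_diffQuot hw s i), elaplacian_diffQuot hw]
    simp only [pd_diffQuot (differentiable_of_contDiff_two hw)]
  have hLF : ContDiffAt ℝ 1 (elaplacian w) x := hF.neg.congr_of_eventuallyEq hwF
  have hpdLF : ∀ i, pd i (elaplacian w) x = -pd i F x := fun i => by
    rw [pd_congr hwF, (hF.differentiableAt (by norm_num)).hasFDerivAt.fun_neg.pd_eq]; rfl
  have hlim : Tendsto (fun p : ℝ × Euc n => elaplacian (g p.1) p.2) (𝓝[≠] 0 ×ˢ 𝓝 x)
      (𝓝 (∑ i, (2 * ∑ j, pd i (pd j w) x ^ 2 + 2 * (pd i w x * pd i (elaplacian w) x)) -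
        elaplacian η x)) := by
    simp only [hlap]
    refine Tendsto.sub (tendsto_finsetSum _ fun i _ => Tendsto.add ?_ ?_)
      (((continuous_elaplacian hη).tendsto x).comp tendsto_snd)
    · exact Tendsto.const_mul _ (tendsto_finsetSum _ fun j _ =>
        (tendsto_diffQuot (hw.pd (m := 1) (by norm_num) j).contDiffAt i).pow 2)
    · exact Tendsto.const_mul _ ((tendsto_diffQuot (hw.of_le (by norm_num)).contDiffAt i).mul
        (tendsto_diffQuot hLF i))
  set κ := Q - (∑ i, pd i w x * pd i F x + elaplacian η x / 2) with hκ
  have hκpos : 0 < κ := sub_pos.2 hlt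
  have hval : ∑ i, (2 * ∑ j, pd i (pd j w) x ^ 2 + 2 * (pd i w x * pd i (elaplacian w) x)) -
      elaplacian η x = 2 * κ := by
    simp only [hpdLF, Finset.sum_add_distrib, ← Finset.mul_sum, mul_neg, Finset.sum_neg_distrib]
    rw [hκ, hQ]; ring
  rw [hval] at hlim
  have hev := hlim.eventually_const_lt (u := κ) (by linarith)
  obtain ⟨P, hP, S, hS, hPS⟩ := eventually_prod_iff.1 hev
  obtain ⟨r, hr, hrS⟩ := Metric.eventually_nhds_iff.1 (hS.and hmax)
  have hsmall : ∀ z, ‖z - x‖ ≤ r / 2 → dist z x < r := fun z hz => by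
    rw [dist_eq_norm]; linarith
  have hineq : ∀ᶠ s in 𝓝[≠] (0 : ℝ),
      κ * (∫ y, ψ y) * (r / 2) ^ 2 / 2 ≤ kavg φ (g s) (r / 2) x - g s x := by
    filter_upwards [hP] with s hs
    exact h.le_kavg_sub (hgC s) (half_pos hr) fun z hz => (hPS hs (hrS (hsmall z hz)).1).le
  have hsub : ∀ s, kavg φ (g s) (r / 2) x =
      kavg φ (fun y => ∑ i, diffQuot s i w y ^ 2) (r / 2) x - kavg φ η (r / 2) x := by
    intro s
    simp only [hg, kavg, mul_sub]
    exact integral_sub (h.left.integrable_mul (continuous_comp_affine (hZs s).continuous x _))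
      (h.left.integrable_mul (continuous_comp_affine hη.continuous x _))
  have hzc : Continuous fun y => ∑ i, pd i w y ^ 2 :=
    continuous_finsetSum _ fun i _ => ((differentiable_pd hw i).continuous.pow 2)
  have hsub0 : kavg φ (fun y => ∑ i, pd i w y ^ 2 - η y) (r / 2) x =
      kavg φ (fun y => ∑ i, pd i w y ^ 2) (r / 2) x - kavg φ η (r / 2) x := by
    simp only [kavg, mul_sub]
    exact integral_sub (h.left.integrable_mul (continuous_comp_affine hzc x _))
      (h.left.integrable_mul (continuous_comp_affine hη.continuous x _))
  have hpt : Tendsto (fun s => g s x) (𝓝[≠] 0) (𝓝 (∑ i, pd i w x ^ 2 - η x)) := by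
    refine Tendsto.sub_const (tendsto_finsetSum _ fun i _ => Tendsto.pow ?_ 2) _
    exact (tendsto_diffQuot (hw.of_le (m := 1) (by norm_num)).contDiffAt (x := x) i).comp
      (tendsto_id.prodMk (tendsto_const_nhds (x := x)))
  have hlim2 : Tendsto (fun s => kavg φ (g s) (r / 2) x - g s x) (𝓝[≠] 0)
      (𝓝 (kavg φ (fun y => ∑ i, pd i w y ^ 2 - η y) (r / 2) x - (∑ i, pd i w x ^ 2 - η x))) := by
    simp only [hsub]
    rw [hsub0]
    exact ((tendsto_kavg_sum_diffQuot_sq h.left hw _ x).sub_const _).sub hpt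
  have hge := ge_of_tendsto hlim2 hineq
  have hle : kavg φ (fun y => ∑ i, pd i w y ^ 2 - η y) (r / 2) x ≤ ∑ i, pd i w x ^ 2 - η x :=
    h.kavg_le_of_forall_le (hzc.sub hη.continuous) (half_pos hr).le
      fun z hz => (hrS (hsmall z hz)).2
  have hpos : 0 < κ * (∫ y, ψ y) * (r / 2) ^ 2 / 2 := by
    have := h.integral_right
    positivity
  linarith

end Bernstein

/-- Normalised logarithms of solutions: `l = log u` solves
`Δl + |∇l|² + a |∇l|^q exp (γ l) = 0` with `|∇l| ≤ 2` on the ball of radius `ρ` about the origin,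
where `l = 0` and `|∇l| = 1`. -/
structure IsProfile {n : ℕ} (q γ a ρ : ℝ) (l : Euc n → ℝ) : Prop where
  contDiff : ContDiff ℝ 2 l
  map_zero : l 0 = 0
  norm_fderiv_zero : ‖fderiv ℝ l 0‖ = 1
  norm_fderiv_le : ∀ x ∈ Metric.ball (0 : Euc n) ρ, ‖fderiv ℝ l x‖ ≤ 2
  eqn : ∀ x ∈ Metric.ball (0 : Euc n) ρ,
    elaplacian l x + ‖fderiv ℝ l x‖ ^ 2 + a * ‖fderiv ℝ l x‖ ^ q * Real.exp (γ * l x) = 0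

namespace IsProfile

variable {n : ℕ} {q γ a ρ : ℝ} {l : Euc n → ℝ}

lemma mono (h : IsProfile q γ a ρ l) {ρ' : ℝ} (hρ : ρ' ≤ ρ) : IsProfile q γ a ρ' l where
  contDiff := h.contDiff
  map_zero := h.map_zero
  norm_fderiv_zero := h.norm_fderiv_zero
  norm_fderiv_le x hx := h.norm_fderiv_le x (Metric.ball_subset_ball hρ hx)
  eqn x hx := h.eqn x (Metric.ball_subset_ball hρ hx)

lemma abs_apply_le (h : IsProfile q γ a ρ l) {x : Euc n} (hx : x ∈ Metric.ball (0 : Euc n) ρ) :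
    |l x| ≤ 2 * ‖x‖ := by
  have h0 : (0 : Euc n) ∈ Metric.ball (0 : Euc n) ρ := by
    rw [mem_ball_zero_iff] at *; simpa using (norm_nonneg x).trans_lt hx
  simpa [h.map_zero] using abs_sub_le_of_fderiv_le (convex_ball _ _)
    (differentiable_of_contDiff_two h.contDiff) h.norm_fderiv_le hx h0

/-- Bernstein's estimate at an interior maximum of `|∇l|² - ε |x|²`. -/
lemma exists_bernstein (hn : 0 < n) (ha : 0 ≤ a) (hq : 0 ≤ q) (h : IsProfile q γ a ρ l) {r : ℝ}
    (hr : 0 < r) (hrρ : r < ρ) :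
    ∃ x ∈ Metric.ball (0 : Euc n) r, 1 ≤ ‖fderiv ℝ l x‖ ∧ ∀ b,
      b = a * ‖fderiv ℝ l x‖ ^ q * Real.exp (γ * l x) →
      (1 + b) ^ 2 ≤ n * ((1 + b * (q / 2)) * (16 / r) + 4 * |γ| * b + 4 * n / r ^ 2) := by
  have hl := h.contDiff
  set z : Euc n → ℝ := fun y => ∑ i, pd i l y ^ 2 with hz
  have hzn : ∀ y, z y = ‖fderiv ℝ l y‖ ^ 2 := fun y => (norm_fderiv_sq_eq_sum_pd l y).symm
  set ε : ℝ := 4 / r ^ 2 with hε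
  have hε0 : 0 < ε := by positivity
  set η : Euc n → ℝ := fun y => ε * ‖y‖ ^ 2 with hη
  have hzC1 : ContDiff ℝ 1 z :=
    ContDiff.sum fun i _ => (hl.pd (m := 1) (by norm_num) i).pow 2
  have hηC : ContDiff ℝ 2 η := contDiff_const.mul (contDiff_norm_sq ℝ)
  obtain ⟨x, hxm, hmax⟩ := (isCompact_closedBall (0 : Euc n) r).exists_isMaxOn
    (Metric.nonempty_closedBall.2 hr.le) (hzC1.continuous.sub hηC.continuous).continuousOn
  have h1 : 1 ≤ z x - η x := by
    have := hmax (Metric.mem_closedBall_self hr.le)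
    have h0 : z 0 - η 0 = 1 := by rw [hzn, h.norm_fderiv_zero]; simp [hη]
    exact h0.symm.le.trans this
  have hη0 : 0 ≤ η x := by positivity
  have hxr : ‖x‖ ≤ r := by simpa using hxm
  have hxρ : x ∈ Metric.ball (0 : Euc n) ρ := by rw [mem_ball_zero_iff]; linarith
  have hz1 : 1 ≤ z x := by linarith
  have hz4 : z x ≤ 4 := by
    rw [hzn]; nlinarith [h.norm_fderiv_le x hxρ, norm_nonneg (fderiv ℝ l x)]
  have hxlt : ‖x‖ < r := by
    refine lt_of_le_of_ne hxr fun hcon => ?_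
    have : η x = 4 := by rw [hη]; simp only [hcon, hε]; field_simp
    linarith
  have hloc : IsLocalMax (fun y => z y - η y) x :=
    hmax.isLocalMax (mem_of_superset (Metric.isOpen_ball.mem_nhds (mem_ball_zero_iff.2 hxlt))
      Metric.ball_subset_closedBall)
  have hN1 : 1 ≤ ‖fderiv ℝ l x‖ := by
    have := hzn x; nlinarith [norm_nonneg (fderiv ℝ l x)]
  refine ⟨x, mem_ball_zero_iff.2 hxlt, hN1, fun b hb => ?_⟩
  have hpow : ∀ y, ‖fderiv ℝ l y‖ ^ q = z y ^ (q / 2) := fun y => by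
    rw [hzn, ← Real.rpow_natCast, ← Real.rpow_mul (norm_nonneg _)]; congr 1; push_cast; ring
  set F : Euc n → ℝ := fun y => z y + a * z y ^ (q / 2) * Real.exp (γ * l y) with hF
  have hz0 : z x ≠ 0 := by linarith
  have hFC : ContDiffAt ℝ 1 F x :=
    hzC1.contDiffAt.add ((contDiffAt_const.mul (hzC1.contDiffAt.rpow_const_of_ne hz0)).mul
      (Real.contDiff_exp.contDiffAt.comp x
        (contDiff_const.mul (hl.of_le (by norm_num))).contDiffAt))
  have hwF : elaplacian l =ᶠ[𝓝 x] fun y => -F y := by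
    filter_upwards [Metric.isOpen_ball.mem_nhds hxρ] with y hy
    have := h.eqn y hy
    rw [hpow, ← hzn] at this
    simp only [hF]; linarith
  have key := bernstein_of_isLocalMax hn hl hFC hηC hwF hloc
  have hzd : DifferentiableAt ℝ z x := (hzC1.differentiable (by norm_num)) x
  have hηd : DifferentiableAt ℝ η x := (hηC.differentiable (by norm_num)) x
  have hld : DifferentiableAt ℝ l x := differentiable_of_contDiff_two hl x
  have hpz : ∀ i, pd i z x = 2 * ε * x i := fun i => by
    have h2 : pd i (fun y => z y - η y) x = 0 := by
      rw [pd, hloc.fderiv_eq_zero]; rfl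
    have h3 : pd i η x = ε * (2 * x i) := by
      rw [hη, pd_const_mul ε ((contDiff_norm_sq ℝ (n := 1)).differentiable (by norm_num) x),
        pd_norm_sq]
    rw [pd_sub hzd hηd, h3] at h2
    linarith
  have hpF : ∀ i, pd i F x = (1 + b * (q / 2) / z x) * (2 * ε * x i) + b * γ * pd i l x := by
    intro i
    have e1 : DifferentiableAt ℝ (fun y => z y ^ (q / 2)) x := hzd.rpow_const (Or.inl hz0)
    have e2 : DifferentiableAt ℝ (fun y => Real.exp (γ * l y)) x := (hld.const_mul γ).exp
    have e3 : pd i (fun y => z y ^ (q / 2)) x = (q / 2 * z x ^ (q / 2 - 1)) * pd i z x :=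
      pd_comp (h := fun t => t ^ (q / 2)) (Real.hasDerivAt_rpow_const (Or.inl hz0)) hzd i
    have e4 : pd i (fun y => Real.exp (γ * l y)) x = Real.exp (γ * l x) * γ * pd i l x := by
      refine pd_comp (h := fun t => Real.exp (γ * t)) ?_ hld i
      simpa using ((hasDerivAt_id (l x)).const_mul γ).exp
    rw [hF, pd_add hzd ((e1.const_mul a).fun_mul e2), pd_mul (e1.const_mul a) e2,
      pd_const_mul a e1, e3, e4, hpz, hb, hpow, Real.rpow_sub (by linarith), Real.rpow_one]
    field_simp
    ring
  have hsum : ∑ i, pd i l x * pd i F x =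
      (1 + b * (q / 2) / z x) * (2 * ε * fderiv ℝ l x x) + b * γ * z x := by
    rw [fderiv_apply_eq_sum_pd, hz]
    simp only [hpF, Finset.mul_sum, ← Finset.sum_add_distrib]
    exact Finset.sum_congr rfl fun i _ => by ring
  have hηΔ : elaplacian η x = 2 * n * ε := by
    rw [hη, elaplacian_const_mul ε (contDiff_norm_sq ℝ), elaplacian_norm_sq]; ring
  have hLx : elaplacian l x = -(z x + b) := by
    rw [hwF.self_of_nhds, hF, hb, hpow]
  have hb0 : 0 ≤ b := by rw [hb]; positivity
  have hS : |fderiv ℝ l x x| ≤ 2 * r := by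
    refine ((fderiv ℝ l x).le_opNorm x).trans ?_
    exact mul_le_mul (h.norm_fderiv_le x hxρ) hxr (norm_nonneg _) (by norm_num)
  rw [hLx, hsum, hηΔ] at key
  have hS2 : 2 * ε * fderiv ℝ l x x ≤ 16 / r := by
    calc 2 * ε * fderiv ℝ l x x ≤ 2 * ε * (2 * r) := by gcongr; exact (le_abs_self _).trans hS
      _ = 16 / r := by rw [hε]; field_simp; norm_num
  have hc : 1 + b * (q / 2) / z x ≤ 1 + b * (q / 2) := by
    gcongr; exact div_le_self (by positivity) hz1
  have hc0 : 0 ≤ 1 + b * (q / 2) / z x := by positivity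
  have hT : (1 + b * (q / 2) / z x) * (2 * ε * fderiv ℝ l x x) ≤ (1 + b * (q / 2)) * (16 / r) :=
    (mul_le_mul_of_nonneg_left hS2 hc0).trans (mul_le_mul_of_nonneg_right hc (by positivity))
  have hG : b * γ * z x ≤ 4 * |γ| * b := by
    have : γ * z x ≤ |γ| * 4 :=
      (mul_le_mul_of_nonneg_right (le_abs_self γ) (by linarith)).trans
        (mul_le_mul_of_nonneg_left hz4 (abs_nonneg _))
    nlinarith
  calc (1 + b) ^ 2 ≤ (-(z x + b)) ^ 2 := by nlinarith
    _ ≤ _ := key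
    _ ≤ _ := by
      have : 2 * (n : ℝ) * ε / 2 = 4 * n / r ^ 2 := by rw [hε]; ring
      rw [this]
      gcongr

/-- The coefficient of a profile on the ball of radius `2` is bounded. -/
lemma coeff_le (hn : 0 < n) (ha : 0 ≤ a) (hq : 0 ≤ q) (h : IsProfile q γ a 2 l) :
    a ≤ n * (16 + 8 * q + 4 * |γ| + 4 * n) * Real.exp (2 * |γ|) := by
  obtain ⟨x, hx, hN, hB⟩ := h.exists_bernstein hn ha hq one_pos one_lt_two
  have hb := hB _ rfl
  set b := a * ‖fderiv ℝ l x‖ ^ q * Real.exp (γ * l x) with hbdef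
  have hx1 : ‖x‖ < 1 := by simpa using hx
  have hl2 : |l x| ≤ 2 := by
    have := h.abs_apply_le (x := x) (by rw [mem_ball_zero_iff]; linarith)
    linarith
  have hn1 : (1 : ℝ) ≤ n := by exact_mod_cast hn
  have hb0 : 0 ≤ b := by positivity
  have hab : a * Real.exp (-(2 * |γ|)) ≤ b := by
    rw [hbdef]
    have h1 : a ≤ a * ‖fderiv ℝ l x‖ ^ q :=
      le_mul_of_one_le_right ha (Real.one_le_rpow hN hq)
    have h2 : -(2 * |γ|) ≤ γ * l x := by
      have := neg_abs_le (γ * l x)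
      rw [abs_mul] at this
      nlinarith [abs_nonneg γ]
    gcongr
  have hγ := abs_nonneg γ
  have hbD : b ≤ n * (16 + 8 * q + 4 * |γ| + 4 * n) := by
    rcases le_total b 1 with hb1 | hb1
    · nlinarith
    · have h3 : b * b ≤ b * (n * (16 + 8 * q + 4 * |γ| + 4 * n)) := by
        have h4 : (1 + b * (q / 2)) * (16 / 1) + 4 * |γ| * b + 4 * n / 1 ^ 2 ≤
            b * (16 + 8 * q + 4 * |γ| + 4 * n) := by nlinarith
        calc b * b ≤ (1 + b) ^ 2 := by nlinarith
          _ ≤ _ := hb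
          _ ≤ n * (b * (16 + 8 * q + 4 * |γ| + 4 * n)) := by gcongr
          _ = _ := by ring
      exact le_of_mul_le_mul_left h3 (by linarith)
  calc a = a * Real.exp (-(2 * |γ|)) * Real.exp (2 * |γ|) := by
        rw [mul_assoc, ← Real.exp_add]; simp
    _ ≤ _ := mul_le_mul_of_nonneg_right (hab.trans hbD) (Real.exp_pos _).le

/-- There is no profile with vanishing coefficient on large balls. -/
lemma coeff_ne_zero (hn : 0 < n) (hq : 0 ≤ q) (h : IsProfile q γ 0 (64 * n) l) : False := by
  have hn1 : (1 : ℝ) ≤ n := by exact_mod_cast hn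
  obtain ⟨x, -, -, hB⟩ := h.exists_bernstein hn le_rfl hq (r := 32 * n) (by linarith) (by linarith)
  have hb := hB 0 (by simp)
  have : n * ((1 + 0 * (q / 2)) * (16 / (32 * n)) + 4 * |γ| * 0 + 4 * n / (32 * (n : ℝ)) ^ 2) =
      1 / 2 + 1 / 256 := by field_simp; norm_num
  rw [this] at hb
  norm_num at hb

end IsProfile

section Compactness

variable {n : ℕ} {q γ : ℝ}

lemma norm_clm_le_sum_abs (T : Euc n →L[ℝ] ℝ) : ‖T‖ ≤ ∑ i, |T (EuclideanSpace.single i 1)| := by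
  refine T.opNorm_le_bound (Finset.sum_nonneg fun i _ => abs_nonneg _) fun v => ?_
  have hv : T v = ∑ i, v i * T (EuclideanSpace.single i 1) := by
    conv_lhs => rw [← (EuclideanSpace.basisFun (Fin n) ℝ).sum_repr v]
    simp [map_sum]
  rw [hv, Finset.sum_mul]
  refine (norm_sum_le _ _).trans (Finset.sum_le_sum fun i _ => ?_)
  rw [norm_mul, mul_comm]
  exact mul_le_mul_of_nonneg_left (PiLp.norm_apply_le v i) (abs_nonneg _)

lemma norm_fderiv_sub_le_sum_pd (f : Euc n → ℝ) (x x' : Euc n) :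
    ‖fderiv ℝ f x - fderiv ℝ f x'‖ ≤ ∑ i, |pd i f x - pd i f x'| :=
  norm_clm_le_sum_abs _

lemma exists_abs_rpow_sub_le (hq : 0 ≤ q) : ∃ β : ℝ, 0 < β ∧ β ≤ 1 ∧ ∃ K : ℝ, 0 ≤ K ∧
    ∀ s ∈ Icc (0 : ℝ) 2, ∀ t ∈ Icc (0 : ℝ) 2, |s ^ q - t ^ q| ≤ K * |s - t| ^ β := by
  rcases hq.eq_or_lt with rfl | hq0
  · exact ⟨1, one_pos, le_rfl, 0, le_rfl, by simp⟩
  rcases le_total q 1 with hq1 | hq1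
  · refine ⟨q, hq0, hq1, 1, zero_le_one, ?_⟩
    have key : ∀ s t : ℝ, 0 ≤ t → t ≤ s → |s ^ q - t ^ q| ≤ 1 * |s - t| ^ q := by
      intro s t ht hts
      rw [abs_of_nonneg (sub_nonneg.2 (Real.rpow_le_rpow ht hts hq)),
        abs_of_nonneg (sub_nonneg.2 hts)]
      have := Real.rpow_add_le_add_rpow ht (sub_nonneg.2 hts) hq hq1
      rw [add_sub_cancel] at this
      linarith
    intro s hs t ht
    rcases le_total t s with h | h
    · exact key s t ht.1 h
    · rw [abs_sub_comm, abs_sub_comm s]; exact key t s hs.1 h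
  · refine ⟨1, one_pos, le_rfl, q * 2 ^ (q - 1), by positivity, fun s hs t ht => ?_⟩
    rw [Real.rpow_one]
    refine (convex_Icc (0 : ℝ) 2).norm_image_sub_le_of_norm_hasDerivWithin_le
      (f := fun x => x ^ q) (f' := fun x => q * x ^ (q - 1))
      (fun x _ => (Real.hasDerivAt_rpow_const (Or.inr hq1)).hasDerivWithinAt) (fun x hx => ?_) ht hs
    rw [Real.norm_of_nonneg (by have := hx.1; positivity)]
    have := Real.rpow_le_rpow hx.1 hx.2 (sub_nonneg.2 hq1)
    gcongr

namespace IsProfile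

lemma abs_mul_le {a ρ : ℝ} {l : Euc n → ℝ} (h : IsProfile q γ a ρ l) {x : Euc n}
    (hx : x ∈ Metric.ball (0 : Euc n) ρ) : γ * l x ≤ |γ| * (2 * ρ) := by
  refine (le_abs_self _).trans ?_
  rw [abs_mul]
  have := h.abs_apply_le hx
  rw [mem_ball_zero_iff] at hx
  gcongr; linarith

lemma exists_abs_elaplacian_le (hq : 0 ≤ q) (γ : ℝ) {A : ℝ} (hA : 0 ≤ A) (n : ℕ) (ρ : ℝ) :
    ∃ B, 0 ≤ B ∧ ∀ (a : ℝ) (l : Euc n → ℝ), 0 ≤ a → a ≤ A → IsProfile q γ a ρ l →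
      ∀ x ∈ Metric.ball (0 : Euc n) ρ, |elaplacian l x| ≤ B := by
  refine ⟨4 + A * 2 ^ q * Real.exp (|γ| * (2 * ρ)), by positivity, fun a l ha haA h x hx => ?_⟩
  have he := h.eqn x hx
  have hN := h.norm_fderiv_le x hx
  have hγ := h.abs_mul_le hx
  have h1 : a * ‖fderiv ℝ l x‖ ^ q * Real.exp (γ * l x) ≤
      A * 2 ^ q * Real.exp (|γ| * (2 * ρ)) := by gcongr
  have h0 : 0 ≤ a * ‖fderiv ℝ l x‖ ^ q * Real.exp (γ * l x) := by positivity
  rw [abs_le]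
  constructor <;> nlinarith [norm_nonneg (fderiv ℝ l x)]

lemma exists_abs_pd_sub_le (hn : 0 < n) (hq : 0 ≤ q) (γ : ℝ) {A : ℝ} (hA : 0 ≤ A) (ρ : ℝ) :
    ∃ H, 0 ≤ H ∧ ∀ (a : ℝ) (l : Euc n → ℝ), 0 ≤ a → a ≤ A → IsProfile q γ a (ρ + 1) l →
      ∀ x ∈ Metric.ball (0 : Euc n) ρ, ∀ x' ∈ Metric.ball (0 : Euc n) ρ, ‖x - x'‖ ≤ 1 →
        ‖fderiv ℝ l x - fderiv ℝ l x'‖ ≤ H * ‖x - x'‖ ^ (1 / 2 : ℝ) := by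
  obtain ⟨φ, ψ, hφ⟩ := exists_isKernelPair hn
  obtain ⟨B, hB0, hB⟩ := exists_abs_elaplacian_le hq γ hA n (ρ + 1)
  refine ⟨∑ j, (2 * ((∫ y, |pd j ψ y|) * B) + 2 * ∫ y, |pd j φ y|), ?_, ?_⟩
  · exact Finset.sum_nonneg fun j _ => by positivity
  intro a l ha haA h x hx x' hx' hxx
  refine (norm_fderiv_sub_le_sum_pd l x x').trans ?_
  rw [Finset.sum_mul]
  refine Finset.sum_le_sum fun j _ => ?_
  rcases eq_or_ne x x' with rfl | hne
  · simp
  have hd : 0 < ‖x - x'‖ := norm_pos_iff.2 (sub_ne_zero.2 hne)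
  set t := ‖x - x'‖ ^ (1 / 2 : ℝ) with ht
  have ht0 : 0 < t := by positivity
  have ht1 : t ≤ 1 := Real.rpow_le_one hd.le hxx (by norm_num)
  have htt : ‖x - x'‖ = t * t := by
    rw [ht, ← Real.rpow_add hd]; norm_num
  have := hφ.abs_pd_sub_le h.contDiff h.norm_fderiv_le (hB a l ha haA h) ht0 ht1 hx hx' j
  refine this.trans_eq ?_
  rw [htt]
  field_simp

lemma exists_abs_elaplacian_sub_le (hn : 0 < n) (hq : 0 ≤ q) (γ : ℝ) {A : ℝ} (hA : 0 ≤ A)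
    (ρ : ℝ) : ∃ α : ℝ, 0 < α ∧ ∃ H, 0 ≤ H ∧ ∀ (a : ℝ) (l : Euc n → ℝ), 0 ≤ a → a ≤ A →
      IsProfile q γ a (ρ + 1) l →
      ∀ x ∈ Metric.ball (0 : Euc n) ρ, ∀ x' ∈ Metric.ball (0 : Euc n) ρ, ‖x - x'‖ ≤ 1 →
        |elaplacian l x - elaplacian l x'| ≤ H * ‖x - x'‖ ^ α := by
  obtain ⟨H, hH0, hH⟩ := exists_abs_pd_sub_le hn hq γ hA ρ
  obtain ⟨β, hβ0, hβ1, K, hK0, hK⟩ := exists_abs_rpow_sub_le hq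
  set E := Real.exp (|γ| * (2 * ρ)) with hE
  refine ⟨β / 2, by positivity, 4 * H + A * ((K * H ^ β) * E + 2 ^ q * (E * (|γ| * 2))),
    by positivity, fun a l ha haA h x hx x' hx' hxx => ?_⟩
  have h' := h.mono (by linarith : ρ ≤ ρ + 1)
  have hsub := Metric.ball_subset_ball (x := (0 : Euc n)) (by linarith : ρ ≤ ρ + 1)
  have hN2 := h'.norm_fderiv_le x hx
  have hN2' := h'.norm_fderiv_le x' hx'
  have hl := abs_sub_le_of_fderiv_le (convex_ball _ _)
    (differentiable_of_contDiff_two h.contDiff) h'.norm_fderiv_le hx hx'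
  have he := h'.eqn x hx
  have he' := h'.eqn x' hx'
  have hγ := h'.abs_mul_le hx
  have hγ' := h'.abs_mul_le hx'
  have hNN : |‖fderiv ℝ l x‖ - ‖fderiv ℝ l x'‖| ≤ H * ‖x - x'‖ ^ (1 / 2 : ℝ) :=
    (abs_norm_sub_norm_le _ _).trans (hH a l ha haA h x hx x' hx' hxx)
  set N := ‖fderiv ℝ l x‖
  set N' := ‖fderiv ℝ l x'‖
  have hN0 : 0 ≤ N := norm_nonneg _
  have hN0' : 0 ≤ N' := norm_nonneg _
  set d := ‖x - x'‖ with hd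
  have hd0 : 0 ≤ d := norm_nonneg _
  have hd1 : d ^ (1 / 2 : ℝ) ≤ d ^ (β / 2) := by
    rcases hd0.eq_or_lt with h0 | h0
    · rw [← h0, Real.zero_rpow (by norm_num), Real.zero_rpow (by positivity)]
    · exact Real.rpow_le_rpow_of_exponent_ge h0 hxx (by linarith)
  have hd2 : d ≤ d ^ (β / 2) := by
    rcases hd0.eq_or_lt with h0 | h0
    · rw [← h0, Real.zero_rpow (by positivity)]
    · simpa using Real.rpow_le_rpow_of_exponent_ge h0 hxx (by linarith : β / 2 ≤ 1)
  have i1 : |N ^ 2 - N' ^ 2| ≤ 4 * H * d ^ (β / 2) := by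
    have : N ^ 2 - N' ^ 2 = (N + N') * (N - N') := by ring
    rw [this, abs_mul, abs_of_nonneg (by positivity)]
    calc (N + N') * |N - N'| ≤ 4 * (H * d ^ (1 / 2 : ℝ)) := by gcongr; linarith
      _ ≤ 4 * (H * d ^ (β / 2)) := by gcongr
      _ = _ := by ring
  have i2 : |N ^ q - N' ^ q| ≤ K * H ^ β * d ^ (β / 2) := by
    refine (hK N ⟨hN0, hN2⟩ N' ⟨hN0', hN2'⟩).trans ?_
    have : |N - N'| ^ β ≤ (H * d ^ (1 / 2 : ℝ)) ^ β := by gcongr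
    rw [Real.mul_rpow hH0 (by positivity), ← Real.rpow_mul hd0] at this
    rw [mul_assoc]
    refine mul_le_mul_of_nonneg_left (this.trans_eq ?_) hK0
    congr 2; ring
  have i3 : |Real.exp (γ * l x) - Real.exp (γ * l x')| ≤ E * (|γ| * 2) * d ^ (β / 2) := by
    have hexp : |Real.exp (γ * l x) - Real.exp (γ * l x')| ≤ E * |γ * l x - γ * l x'| :=
      (convex_Iic (|γ| * (2 * ρ))).norm_image_sub_le_of_norm_hasDerivWithin_le
        (f := Real.exp) (f' := Real.exp) (fun y _ => (Real.hasDerivAt_exp y).hasDerivWithinAt)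
        (fun y hy => by rw [Real.norm_of_nonneg (Real.exp_pos y).le]; exact Real.exp_le_exp.2 hy)
        hγ' hγ
    refine hexp.trans ?_
    rw [← mul_sub, abs_mul]
    calc E * (|γ| * |l x - l x'|) ≤ E * (|γ| * (2 * d ^ (β / 2))) := by
          gcongr; exact hl.trans (by gcongr)
      _ = _ := by ring
  have hsplit : elaplacian l x - elaplacian l x' =
      -((N ^ 2 - N' ^ 2) + a * ((N ^ q - N' ^ q) * Real.exp (γ * l x) +
        N' ^ q * (Real.exp (γ * l x) - Real.exp (γ * l x')))) := by linarith
  rw [hsplit, abs_neg]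
  calc _ ≤ |N ^ 2 - N' ^ 2| + a * (|N ^ q - N' ^ q| * Real.exp (γ * l x) +
        N' ^ q * |Real.exp (γ * l x) - Real.exp (γ * l x')|) := by
        refine (abs_add_le _ _).trans ?_
        rw [abs_mul, abs_of_nonneg ha]
        gcongr
        refine (abs_add_le _ _).trans ?_
        rw [abs_mul, abs_mul, abs_of_pos (Real.exp_pos _),
          abs_of_nonneg (Real.rpow_nonneg hN0' q)]
    _ ≤ 4 * H * d ^ (β / 2) + A * (K * H ^ β * d ^ (β / 2) * E +
        2 ^ q * (E * (|γ| * 2) * d ^ (β / 2))) := by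
        gcongr
        exact Real.exp_le_exp.2 hγ
    _ = _ := by ring

/-- Uniform bounds for the second derivatives of profiles. -/
lemma exists_abs_pd_pd_le (hn : 0 < n) (hq : 0 ≤ q) (γ : ℝ) {A : ℝ} (hA : 0 ≤ A) (ρ : ℝ)
    (j k : Fin n) : ∃ D, ∀ (a : ℝ) (l : Euc n → ℝ), 0 ≤ a → a ≤ A → IsProfile q γ a (ρ + 2) l →
      ∀ x ∈ Metric.ball (0 : Euc n) ρ, |pd j (pd k l) x| ≤ D := by
  obtain ⟨φ, ψ, hφ⟩ := exists_isKernelPair hn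
  obtain ⟨α, hα, H, hH0, hH⟩ := exists_abs_elaplacian_sub_le hn hq γ hA (ρ + 1)
  refine ⟨_, fun a l ha haA h x hx => hφ.abs_pd_pd_le h.contDiff hα hH0
    (h.mono (by linarith)).norm_fderiv_le (fun z hz z' hz' hzz => hH a l ha haA ?_ z hz z' hz' hzz)
    hx j k⟩
  exact h.mono (by linarith)

/-- Uniform equicontinuity of the second derivatives of profiles. -/
lemma exists_abs_pd_pd_sub_lt (hn : 0 < n) (hq : 0 ≤ q) (γ : ℝ) {A : ℝ} (hA : 0 ≤ A) (ρ : ℝ)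
    (j k : Fin n) {ε : ℝ} (hε : 0 < ε) : ∃ δ > 0, ∀ (a : ℝ) (l : Euc n → ℝ), 0 ≤ a → a ≤ A →
      IsProfile q γ a (ρ + 2) l → ∀ x ∈ Metric.ball (0 : Euc n) ρ,
        ∀ x' ∈ Metric.ball (0 : Euc n) ρ, ‖x - x'‖ < δ →
          |pd j (pd k l) x - pd j (pd k l) x'| < ε := by
  obtain ⟨φ, ψ, hφ⟩ := exists_isKernelPair hn
  obtain ⟨α, hα, H, hH0, hH⟩ := exists_abs_elaplacian_sub_le hn hq γ hA (ρ + 1)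
  have key := fun (a : ℝ) (l : Euc n → ℝ) (ha : 0 ≤ a) (haA : a ≤ A)
    (h : IsProfile q γ a (ρ + 2) l) (t : ℝ) (ht : 0 < t) (ht1 : t ≤ 1) (x : Euc n)
    (hx : x ∈ Metric.ball (0 : Euc n) ρ) (x' : Euc n) (hx' : x' ∈ Metric.ball (0 : Euc n) ρ) =>
      hφ.abs_pd_pd_sub_le h.contDiff hα hH0 (h.mono (by linarith : ρ + 1 ≤ ρ + 2)).norm_fderiv_le
        (hH a l ha haA (h.mono (by linarith))) ht ht1 hx hx' j k
  set c₁ := ∫ y, |pd k (pd j ψ) y|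
  set c₂ := ∫ y, |pd k (pd j φ) y|
  have l1 : Tendsto (fun t : ℝ => 2 * (c₁ * (H * (t ^ α / α)))) (𝓝[>] 0) (𝓝 0) := by
    have h0 : Tendsto (fun t : ℝ => t ^ α) (𝓝 0) (𝓝 0) := by
      simpa [Real.zero_rpow hα.ne'] using (Real.continuousAt_rpow_const 0 α (Or.inr hα.le)).tendsto
    simpa using (((((h0.div_const α).const_mul H).const_mul c₁).const_mul 2)).mono_left
      nhdsWithin_le_nhds
  obtain ⟨t, ht, ht0, ht1⟩ := ((l1.eventually_lt_const (half_pos hε)).and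
    (Ioc_mem_nhdsGT (zero_lt_one' ℝ))).exists
  have l2 : Tendsto (fun d : ℝ => t⁻¹ * t⁻¹ * (c₂ * (2 * d))) (𝓝 0) (𝓝 0) := by
    have h0 : Continuous fun d : ℝ => t⁻¹ * t⁻¹ * (c₂ * (2 * d)) := by fun_prop
    simpa using h0.tendsto 0
  obtain ⟨δ, hδ, hδ'⟩ := Metric.eventually_nhds_iff.1 (l2.eventually_lt_const (half_pos hε))
  refine ⟨δ, hδ, fun a l ha haA h x hx x' hx' hxx => ?_⟩
  have h1 := key a l ha haA h t ht0 ht1 x hx x' hx'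
  have h2 := @hδ' ‖x - x'‖ (by simpa using hxx)
  linarith

end IsProfile

end Compactness

section Limits

variable {n : ℕ} {𝒰 : Filter ℕ}

lemma tendsto_prod_of_tendsto {P : ℕ → Euc n → ℝ} {x : Euc n} {c : ℝ}
    (hc : Tendsto (fun k => P k x) 𝒰 (𝓝 c))
    (h : ∀ ε > 0, ∃ δ > 0, ∀ᶠ k in 𝒰, ∀ y, ‖y - x‖ < δ → |P k y - P k x| < ε) :
    Tendsto (fun p : ℕ × Euc n => P p.1 p.2) (𝒰 ×ˢ 𝓝 x) (𝓝 c) := by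
  have h0 : Tendsto (fun p : ℕ × Euc n => P p.1 p.2 - P p.1 x) (𝒰 ×ˢ 𝓝 x) (𝓝 0) := by
    refine Metric.tendsto_nhds.2 fun ε hε => ?_
    obtain ⟨δ, hδ, hk⟩ := h ε hε
    refine (hk.prod_mk (Metric.ball_mem_nhds x hδ)).mono fun p hp => ?_
    rw [dist_zero_right]
    exact hp.1 p.2 (mem_ball_iff_norm.1 hp.2)
  simpa using h0.add (hc.comp tendsto_fst)

variable [𝒰.NeBot]

lemma continuous_of_tendsto_prod {P : ℕ → Euc n → ℝ} {G : Euc n → ℝ}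
    (h : ∀ x, Tendsto (fun p : ℕ × Euc n => P p.1 p.2) (𝒰 ×ˢ 𝓝 x) (𝓝 (G x))) :
    Continuous G := by
  refine continuous_iff_continuousAt.2 fun x => Metric.tendsto_nhds.2 fun ε hε => ?_
  have h1 := Metric.tendsto_nhds.1 (h x) (ε / 2) (half_pos hε)
  obtain ⟨p, hp, r, hr, hpr⟩ := eventually_prod_iff.1 h1
  filter_upwards [hr] with y hy
  have h2 : Tendsto (fun k => P k y) 𝒰 (𝓝 (G y)) :=
    (h y).comp (tendsto_id.prodMk (tendsto_const_nhds (x := y)))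
  exact (le_of_tendsto (h2.dist tendsto_const_nhds)
    (hp.mono fun k hk => (hpr hk hy).le)).trans_lt (half_lt_self hε)

/-- Limits of differentiable functions whose partial derivatives converge continuously. -/
lemma hasFDerivAt_of_tendsto_prod {f : ℕ → Euc n → ℝ} {g : Euc n → ℝ} {G : Fin n → Euc n → ℝ}
    (hf : ∀ k, Differentiable ℝ (f k)) (hg : ∀ x, Tendsto (fun k => f k x) 𝒰 (𝓝 (g x)))
    (hG : ∀ i x, Tendsto (fun p : ℕ × Euc n => pd i (f p.1) p.2) (𝒰 ×ˢ 𝓝 x) (𝓝 (G i x)))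
    (x : Euc n) :
    HasFDerivAt g (∑ i, G i x • (EuclideanSpace.proj i : Euc n →L[ℝ] ℝ)) x := by
  set T : Euc n → Euc n →L[ℝ] ℝ := fun y => ∑ i, G i y • EuclideanSpace.proj i with hT
  have hrep : ∀ k y, fderiv ℝ (f k) y = ∑ i, pd i (f k) y • EuclideanSpace.proj i := by
    intro k y
    ext v
    rw [fderiv_apply_eq_sum_pd]
    simp [mul_comm]
  have hTc : Continuous T :=
    continuous_finsetSum _ fun i _ =>
      (continuous_of_tendsto_prod (P := fun k => pd i (f k)) (hG i)).smul continuous_const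
  have hlim : Tendsto (fun p : ℕ × Euc n => fderiv ℝ (f p.1) p.2) (𝒰 ×ˢ 𝓝 x) (𝓝 (T x)) := by
    simp only [hrep]
    exact tendsto_finsetSum _ fun i _ => (hG i x).smul_const _
  refine hasFDerivAt_of_tendstoUniformlyOnFilter (l := 𝒰) (f := f) (g' := T)
    (f' := fun k => fderiv ℝ (f k)) ?_ (Eventually.of_forall fun p => (hf p.1 p.2).hasFDerivAt)
    (Eventually.of_forall hg)
  rw [tendstoUniformlyOnFilter_iff_tendsto]
  have h2 : Tendsto (fun p : ℕ × Euc n => T p.2) (𝒰 ×ˢ 𝓝 x) (𝓝 (T x)) :=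
    (hTc.tendsto x).comp tendsto_snd
  exact (h2.prodMk_nhds hlim).mono_right (nhds_le_uniformity (T x))

lemma contDiff_succ_of_pd {m : ℕ} {g : Euc n → ℝ} (hg : Differentiable ℝ g)
    (h : ∀ i, ContDiff ℝ m (pd i g)) : ContDiff ℝ (m + 1) g := by
  refine contDiff_succ_iff_fderiv_apply.2 ⟨hg, by simp, fun v => ?_⟩
  simp only [fderiv_apply_eq_sum_pd]
  exact ContDiff.sum fun i _ => contDiff_const.mul (h i)

lemma exists_tendsto_of_abs_le {𝒱 : Ultrafilter ℕ} {s : ℕ → ℝ} {B : ℝ}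
    (h : ∀ᶠ k in (𝒱 : Filter ℕ), |s k| ≤ B) : ∃ c, Tendsto s 𝒱 (𝓝 c) := by
  obtain ⟨c, -, hc⟩ := (isCompact_Icc (a := -B) (b := B)).ultrafilter_le_nhds (𝒱.map s)
    (by
      rw [le_principal_iff]
      exact h.mono fun k hk => _root_.abs_le.1 hk)
  exact ⟨c, hc⟩


namespace IsProfile

variable {q γ A : ℝ} {a : ℕ → ℝ} {l : ℕ → Euc n → ℝ}

lemma exists_abs_pd_sub_lt (hn : 0 < n) (hq : 0 ≤ q) (γ : ℝ) (hA : 0 ≤ A) (ρ : ℝ) (i : Fin n)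
    {ε : ℝ} (hε : 0 < ε) : ∃ δ > 0, ∀ (a : ℝ) (l : Euc n → ℝ), 0 ≤ a → a ≤ A →
      IsProfile q γ a (ρ + 1) l → ∀ x ∈ Metric.ball (0 : Euc n) ρ,
        ∀ x' ∈ Metric.ball (0 : Euc n) ρ, ‖x - x'‖ < δ → |pd i l x - pd i l x'| < ε := by
  obtain ⟨H, hH0, hH⟩ := exists_abs_pd_sub_le hn hq γ hA ρ
  have h0 : Continuous fun d : ℝ => H * d ^ (1 / 2 : ℝ) :=
    continuous_const.mul (Real.continuous_rpow_const (by norm_num))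
  have hlim : Tendsto (fun d : ℝ => H * d ^ (1 / 2 : ℝ)) (𝓝 0) (𝓝 0) := by
    simpa using h0.tendsto 0
  obtain ⟨δ, hδ, hδ'⟩ := Metric.eventually_nhds_iff.1 (hlim.eventually_lt_const hε)
  refine ⟨min δ 1, by positivity, fun a l ha haA h x hx x' hx' hxx => ?_⟩
  have h1 := hH a l ha haA h x hx x' hx' (hxx.le.trans (min_le_right _ _))
  have h2 := @hδ' ‖x - x'‖ (by simpa using hxx.trans_le (min_le_left _ _))
  refine lt_of_le_of_lt ?_ (h1.trans_lt h2)
  have := (fderiv ℝ l x - fderiv ℝ l x').le_opNorm (EuclideanSpace.single i 1)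
  simpa [pd] using this

/-- Profiles on growing balls subconverge to a profile on every ball. -/
theorem exists_limit (hn : 0 < n) (hq : 0 ≤ q) (hA : 0 ≤ A) (ha0 : ∀ k, 0 ≤ a k)
    (haA : ∀ k, a k ≤ A) (h : ∀ k, IsProfile q γ (a k) k (l k)) :
    ∃ c L, Tendsto a (hyperfilter ℕ) (𝓝 c) ∧ ∀ ρ, IsProfile (n := n) q γ c ρ L := by
  have hev : ∀ ρ : ℝ, ∀ᶠ k in (hyperfilter ℕ : Filter ℕ), IsProfile q γ (a k) ρ (l k) :=
    fun ρ => Nat.hyperfilter_le_atTop ((eventually_ge_atTop ⌈ρ⌉₊).mono fun k hk =>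
      (h k).mono (Nat.ceil_le.1 hk))
  have hmem : ∀ x : Euc n, x ∈ Metric.ball (0 : Euc n) (‖x‖ + 1) := fun x => by simp
  obtain ⟨c, hc⟩ := exists_tendsto_of_abs_le (𝒱 := hyperfilter ℕ) (s := a) (B := A)
    (Eventually.of_forall fun k => by rw [abs_of_nonneg (ha0 k)]; exact haA k)
  have hL : ∀ x, ∃ c, Tendsto (fun k => l k x) (hyperfilter ℕ) (𝓝 c) := fun x =>
    exists_tendsto_of_abs_le ((hev _).mono fun k hk => hk.abs_apply_le (hmem x))
  have hP : ∀ i x, ∃ c, Tendsto (fun k => pd i (l k) x) (hyperfilter ℕ) (𝓝 c) := fun i x =>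
    exists_tendsto_of_abs_le ((hev _).mono fun k hk =>
      (abs_pd_le _ _ i).trans (hk.norm_fderiv_le x (hmem x)))
  have hQ : ∀ j i x, ∃ c, Tendsto (fun k => pd j (pd i (l k)) x) (hyperfilter ℕ) (𝓝 c) := by
    intro j i x
    obtain ⟨D, hD⟩ := exists_abs_pd_pd_le hn hq γ hA (‖x‖ + 1) j i
    exact exists_tendsto_of_abs_le ((hev _).mono fun k hk =>
      hD (a k) (l k) (ha0 k) (haA k) hk x (hmem x))
  choose L hL using hL
  choose P hP using hP
  choose Q hQ using hQ
  have hball : ∀ x y : Euc n, ‖y - x‖ < 1 → y ∈ Metric.ball (0 : Euc n) (‖x‖ + 1) := by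
    intro x y hy
    rw [mem_ball_zero_iff]
    have := norm_add_le x (y - x)
    rw [add_sub_cancel] at this
    linarith
  have hPp : ∀ i x, Tendsto (fun p : ℕ × Euc n => pd i (l p.1) p.2)
      ((hyperfilter ℕ : Filter ℕ) ×ˢ 𝓝 x) (𝓝 (P i x)) := fun i x => by
    refine tendsto_prod_of_tendsto (P := fun k => pd i (l k)) (hP i x) fun ε hε => ?_
    obtain ⟨δ, hδ, hδ'⟩ := exists_abs_pd_sub_lt hn hq γ hA (‖x‖ + 1) i hε
    exact ⟨min δ 1, by positivity, (hev _).mono fun k hk y hy =>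
      hδ' (a k) (l k) (ha0 k) (haA k) hk y (hball x y (hy.trans_le (min_le_right _ _))) x (hmem x)
        (hy.trans_le (min_le_left _ _))⟩
  have hQp : ∀ j i x, Tendsto (fun p : ℕ × Euc n => pd j (pd i (l p.1)) p.2)
      ((hyperfilter ℕ : Filter ℕ) ×ˢ 𝓝 x) (𝓝 (Q j i x)) := fun j i x => by
    refine tendsto_prod_of_tendsto (P := fun k => pd j (pd i (l k))) (hQ j i x) fun ε hε => ?_
    obtain ⟨δ, hδ, hδ'⟩ := exists_abs_pd_pd_sub_lt hn hq γ hA (‖x‖ + 1) j i hε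
    exact ⟨min δ 1, by positivity, (hev _).mono fun k hk y hy =>
      hδ' (a k) (l k) (ha0 k) (haA k) hk y (hball x y (hy.trans_le (min_le_right _ _))) x (hmem x)
        (hy.trans_le (min_le_left _ _))⟩
  have hd1 := hasFDerivAt_of_tendsto_prod
    (fun k => differentiable_of_contDiff_two (h k).contDiff) hL hPp
  have hpd : ∀ i, pd i L = P i := fun i => funext fun x => by
    rw [(hd1 x).pd_eq]; simp
  have hd2 := fun i => hasFDerivAt_of_tendsto_prod (f := fun k => pd i (l k))
    (fun k => differentiable_pd (h k).contDiff i) (hP i) (fun j => hQp j i)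
  have hpd2 : ∀ j i, pd j (pd i L) = Q j i := fun j i => funext fun x => by
    rw [hpd, (hd2 i x).pd_eq]; simp
  have hC : ContDiff ℝ 2 L := by
    refine contDiff_succ_of_pd (m := 1) (fun x => (hd1 x).differentiableAt) fun i => ?_
    refine contDiff_succ_of_pd (m := 0) (fun x => ?_) fun j => ?_
    · rw [hpd]; exact (hd2 i x).differentiableAt
    · rw [hpd2]
      exact contDiff_zero.2 (continuous_of_tendsto_prod (P := fun k => pd j (pd i (l k))) (hQp j i))
  have hΔ : ∀ x, Tendsto (fun k => elaplacian (l k) x) (hyperfilter ℕ) (𝓝 (elaplacian L x)) :=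
    fun x => by
      simp only [elaplacian_eq_sum_pd, hpd2]
      exact tendsto_finsetSum _ fun i _ => hQ i i x
  have hN : ∀ x, Tendsto (fun k => ‖fderiv ℝ (l k) x‖) (hyperfilter ℕ) (𝓝 ‖fderiv ℝ L x‖) := by
    intro x
    have hs : ∀ f : Euc n → ℝ, ‖fderiv ℝ f x‖ = √(∑ i, pd i f x ^ 2) := fun f => by
      rw [← norm_fderiv_sq_eq_sum_pd, Real.sqrt_sq (norm_nonneg _)]
    simp only [hs, hpd]
    exact (tendsto_finsetSum _ fun i _ => (hP i x).pow 2).sqrt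
  refine ⟨c, L, hc, fun ρ => ⟨hC, ?_, ?_, fun x hx => ?_, fun x hx => ?_⟩⟩
  · exact tendsto_nhds_unique (hL 0) (tendsto_const_nhds.congr fun k => (h k).map_zero.symm)
  · exact tendsto_nhds_unique (hN 0) (tendsto_const_nhds.congr fun k => (h k).norm_fderiv_zero.symm)
  · exact le_of_tendsto (hN x) ((hev ρ).mono fun k hk => hk.norm_fderiv_le x hx)
  · have hlim := ((hΔ x).add ((hN x).pow 2)).add
      ((hc.mul ((hN x).rpow_const (p := q) (Or.inr hq))).mul ((hL x).const_mul γ).rexp)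
    exact tendsto_nhds_unique hlim
      (tendsto_const_nhds.congr' ((hev ρ).mono fun k hk => (hk.eqn x hx).symm))

end IsProfile

end Limits

section Rescaling

variable {n : ℕ} {f : Euc n → ℝ}

lemma pd_comp_affine_fun (hf : ContDiff ℝ 2 f) (a : Euc n) (t : ℝ) (i : Fin n) :
    pd i (fun y => f (a + t • y)) = fun y => t * pd i f (a + t • y) :=
  funext fun x => pd_comp_affine f a t x (differentiable_of_contDiff_two hf _) i

lemma elaplacian_comp_affine (hf : ContDiff ℝ 2 f) (a : Euc n) (t : ℝ) (x : Euc n) :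
    elaplacian (fun y => f (a + t • y)) x = t ^ 2 * elaplacian f (a + t • x) := by
  simp only [elaplacian_eq_sum_pd, pd_comp_affine_fun hf, Finset.mul_sum]
  refine Finset.sum_congr rfl fun i _ => ?_
  have hd : DifferentiableAt ℝ (fun y => pd i f (a + t • y)) x :=
    (differentiable_pd hf i _).comp x (by fun_prop)
  rw [pd_const_mul t hd, pd_comp_affine _ _ _ _ (differentiable_pd hf i _)]
  ring

lemma norm_fderiv_eq_sqrt (f : Euc n → ℝ) (x : Euc n) :
    ‖fderiv ℝ f x‖ = √(∑ i, pd i f x ^ 2) := by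
  rw [← norm_fderiv_sq_eq_sum_pd, Real.sqrt_sq (norm_nonneg _)]

lemma norm_fderiv_comp_affine (hf : ContDiff ℝ 2 f) (a : Euc n) {t : ℝ} (ht : 0 ≤ t) (x : Euc n) :
    ‖fderiv ℝ (fun y => f (a + t • y)) x‖ = t * ‖fderiv ℝ f (a + t • x)‖ := by
  simp only [norm_fderiv_eq_sqrt, pd_comp_affine_fun hf, mul_pow, ← Finset.mul_sum]
  rw [Real.sqrt_mul (sq_nonneg t), Real.sqrt_sq ht]

lemma pd_mul_exp_fun (hf : ContDiff ℝ 2 f) (c : ℝ) (i : Fin n) :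
    pd i (fun y => c * Real.exp (f y)) = fun y => c * Real.exp (f y) * pd i f y := by
  funext x
  have hfd := differentiable_of_contDiff_two hf x
  rw [pd_const_mul c hfd.exp, pd_comp (Real.hasDerivAt_exp (f x)) hfd]
  ring

lemma elaplacian_mul_exp (hf : ContDiff ℝ 2 f) (c : ℝ) (x : Euc n) :
    elaplacian (fun y => c * Real.exp (f y)) x =
      c * Real.exp (f x) * (elaplacian f x + ‖fderiv ℝ f x‖ ^ 2) := by
  rw [norm_fderiv_sq_eq_sum_pd]
  simp only [elaplacian_eq_sum_pd, pd_mul_exp_fun hf, ← Finset.sum_add_distrib, Finset.mul_sum]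
  refine Finset.sum_congr rfl fun i _ => ?_
  have hd : DifferentiableAt ℝ (fun y => c * Real.exp (f y)) x :=
    (differentiable_of_contDiff_two hf x).exp.const_mul c
  rw [pd_mul hd (differentiable_pd hf i x), pd_mul_exp_fun hf]
  ring

lemma norm_fderiv_mul_exp (hf : ContDiff ℝ 2 f) {c : ℝ} (hc : 0 ≤ c) (x : Euc n) :
    ‖fderiv ℝ (fun y => c * Real.exp (f y)) x‖ = c * Real.exp (f x) * ‖fderiv ℝ f x‖ := by
  simp only [norm_fderiv_eq_sqrt, pd_mul_exp_fun hf, mul_pow, ← Finset.mul_sum]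
  rw [← mul_pow, Real.sqrt_mul (sq_nonneg _), Real.sqrt_sq (by positivity)]

lemma norm_gradient_eq (f : Euc n → ℝ) (x : Euc n) : ‖gradient f x‖ = ‖fderiv ℝ f x‖ :=
  (InnerProductSpace.toDual ℝ (Euc n)).symm.norm_map _

end Rescaling

section Liouville

variable {n : ℕ} {p q a : ℝ}

/-- Coefficients which can be normalised to one by rescaling. -/
def IsScalable (q γ a : ℝ) : Prop := 0 < a ∧ (q = 2 → γ = 0 → a = 1)

lemma IsScalable.exists_scaling {γ : ℝ} (ha : IsScalable q γ a) :
    ∃ t > 0, ∃ c > 0, t ^ 2 * a = t ^ q * c ^ γ := by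
  obtain ⟨ha0, ha1⟩ := ha
  by_cases hq : q = 2
  · by_cases hγ : γ = 0
    · exact ⟨1, one_pos, 1, one_pos, by simp [ha1 hq hγ]⟩
    · refine ⟨1, one_pos, a ^ γ⁻¹, by positivity, ?_⟩
      rw [← Real.rpow_mul ha0.le, inv_mul_cancel₀ hγ]
      simp
  · refine ⟨a ^ (q - 2)⁻¹, by positivity, 1, one_pos, ?_⟩
    set t := a ^ (q - 2)⁻¹ with ht
    have ht0 : 0 < t := by positivity
    have hta : t ^ (q - 2) = a := by
      rw [ht, ← Real.rpow_mul ha0.le, inv_mul_cancel₀ (sub_ne_zero.2 hq), Real.rpow_one]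
    rw [Real.one_rpow, mul_one, ← Real.rpow_natCast, ← hta, ← Real.rpow_add ht0]
    congr 1; push_cast; ring

lemma not_forall_isProfile
    (hLiou : ∀ u : Euc n → ℝ, ContDiff ℝ 2 u → (∀ x, 0 < u x) →
      (∀ x, elaplacian u x + ‖gradient u x‖ ^ q * u x ^ p = 0) → ∀ x y, u x = u y)
    (ha : IsScalable q (p + q - 1) a) {L : Euc n → ℝ}
    (h : ∀ ρ, IsProfile q (p + q - 1) a ρ L) : False := by
  obtain ⟨t, ht, c, hc, htc⟩ := ha.exists_scaling
  have hL := (h 0).contDiff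
  set g : Euc n → ℝ := fun y => L (0 + t • y) with hg
  have hgC : ContDiff ℝ 2 g := hL.comp (by fun_prop)
  set w : Euc n → ℝ := fun y => c * Real.exp (g y) with hw
  have hconst : ∀ x y, w x = w y := by
    refine hLiou w (contDiff_const.mul hgC.exp) (fun x => by positivity) fun x => ?_
    set z : Euc n := 0 + t • x with hz
    have he := (h (‖z‖ + 1)).eqn z (by simp)
    have hexp : Real.exp (g x) = Real.exp (L z) := rfl
    rw [norm_gradient_eq, hw, elaplacian_mul_exp hgC, norm_fderiv_mul_exp hgC hc.le, hexp, hg,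
      elaplacian_comp_affine hL, norm_fderiv_comp_affine hL _ ht.le, ← hz]
    have hE := Real.exp_pos (L z)
    have hN := norm_nonneg (fderiv ℝ L z)
    rw [Real.mul_rpow (by positivity) (by positivity), Real.mul_rpow hc.le hE.le,
      Real.mul_rpow ht.le hN, Real.mul_rpow hc.le hE.le]
    have e1 : c ^ q * c ^ p = c * c ^ (p + q - 1) := by
      have : c * c ^ (p + q - 1) = c ^ (1 + (p + q - 1)) := by
        rw [Real.rpow_add hc, Real.rpow_one]
      rw [this, ← Real.rpow_add hc]
      congr 1; ring
    have e2 : Real.exp (L z) ^ q * Real.exp (L z) ^ p =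
        Real.exp (L z) * Real.exp ((p + q - 1) * L z) := by
      rw [← Real.exp_mul, ← Real.exp_mul, ← Real.exp_add, ← Real.exp_add]
      congr 1; ring
    calc _ = c * Real.exp (L z) * t ^ 2 * (elaplacian L z + ‖fderiv ℝ L z‖ ^ 2) +
          (c ^ q * c ^ p) * (Real.exp (L z) ^ q * Real.exp (L z) ^ p) * t ^ q *
            ‖fderiv ℝ L z‖ ^ q := by ring
      _ = c * Real.exp (L z) * (t ^ 2 * (elaplacian L z + ‖fderiv ℝ L z‖ ^ 2) +
          (t ^ q * c ^ (p + q - 1)) * Real.exp ((p + q - 1) * L z) * ‖fderiv ℝ L z‖ ^ q) := by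
        rw [e1, e2]; ring
      _ = c * Real.exp (L z) * t ^ 2 * (elaplacian L z + ‖fderiv ℝ L z‖ ^ 2 +
          a * ‖fderiv ℝ L z‖ ^ q * Real.exp ((p + q - 1) * L z)) := by rw [← htc]; ring
      _ = 0 := by rw [he, mul_zero]
  have hw0 : ‖fderiv ℝ w 0‖ = 0 := by
    have : w = fun _ => w 0 := funext fun x => hconst x 0
    rw [this]; simp
  rw [hw, norm_fderiv_mul_exp hgC hc.le, hg, norm_fderiv_comp_affine hL _ ht.le] at hw0
  simp only [smul_zero, add_zero, (h 0).norm_fderiv_zero] at hw0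
  have := Real.exp_pos (L 0)
  have : 0 < c * Real.exp (L 0) * (t * 1) := by positivity
  linarith

/-- Under the Liouville property there are no scalable profiles on large balls. -/
theorem exists_not_isProfile (hn : 0 < n) (hq : 0 ≤ q)
    (hLiou : ∀ u : Euc n → ℝ, ContDiff ℝ 2 u → (∀ x, 0 < u x) →
      (∀ x, elaplacian u x + ‖gradient u x‖ ^ q * u x ^ p = 0) → ∀ x y, u x = u y) :
    ∃ ρ > 0, ∀ (a : ℝ) (l : Euc n → ℝ), IsScalable q (p + q - 1) a →
      ¬ IsProfile q (p + q - 1) a ρ l := by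
  by_contra! hcon
  have hcon' := fun k : ℕ => hcon (k + 2) (by positivity)
  choose a l ha h using hcon'
  have hbd : ∀ k, a k ≤ _ := fun k =>
    IsProfile.coeff_le hn (ha k).1.le hq ((h k).mono (by linarith [k.cast_nonneg (α := ℝ)]))
  obtain ⟨c, L, hc, hL⟩ := IsProfile.exists_limit hn hq (by positivity)
    (fun k => (ha k).1.le) hbd (fun k => (h k).mono (by linarith))
  rcases (ge_of_tendsto' hc fun k => (ha k).1.le).eq_or_lt with h0 | h0
  · subst h0
    exact (hL _).coeff_ne_zero hn hq
  · refine not_forall_isProfile hLiou ⟨h0, fun h1 h2 => ?_⟩ hL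
    exact tendsto_nhds_unique hc (tendsto_const_nhds.congr fun k => ((ha k).2 h1 h2).symm)

end Liouville

section GradientEstimate

variable {n : ℕ} {p q ρ : ℝ}

lemma exists_contDiff_eqOn_ball {f : Euc n → ℝ} {z : Euc n} {R : ℝ} (hR : 0 < R)
    (hf : ContDiffOn ℝ 2 f (Metric.ball z R)) :
    ∃ L : Euc n → ℝ, ContDiff ℝ 2 L ∧ EqOn L f (Metric.ball z (R / 2)) := by
  let χ : ContDiffBump z := ⟨R / 2, 3 * R / 4, by positivity, by linarith⟩
  refine ⟨fun x => χ x * f x, contDiff_iff_contDiffAt.2 fun x => ?_, fun x hx => ?_⟩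
  · by_cases hx : x ∈ Metric.ball z R
    · exact χ.contDiffAt.mul (hf.contDiffAt (Metric.isOpen_ball.mem_nhds hx))
    · have hx' : x ∉ tsupport χ := by
        rw [χ.tsupport_eq, Metric.mem_closedBall, not_le]
        rw [Metric.mem_ball, not_lt] at hx
        change 3 * R / 4 < _
        linarith
      have h0 : (fun x => χ x * f x) =ᶠ[𝓝 x] fun _ => 0 := by
        filter_upwards [notMem_tsupport_iff_eventuallyEq.1 hx'] with y hy
        simp [hy]
      exact contDiffAt_const.congr_of_eventuallyEq h0
  · simp [χ.one_of_mem_closedBall (Metric.ball_subset_closedBall hx)]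

/-- Point selection: a large gradient at the centre of a ball forces the existence of a point
around which the gradient at most doubles, on a ball which is large at the natural scale. -/
lemma exists_fderiv_le_two_mul {L : Euc n → ℝ} (hL : ContDiff ℝ 2 L) {z : Euc n} {r : ℝ}
    (hr : 0 < r) (hρ : 0 < ρ) (hz : 2 * ρ < r * ‖fderiv ℝ L z‖) :
    ∃ x, ∃ t > 0, t * ‖fderiv ℝ L x‖ = 1 ∧ Metric.ball x (t * ρ) ⊆ Metric.ball z r ∧
      ∀ y ∈ Metric.ball x (t * ρ), ‖fderiv ℝ L y‖ ≤ 2 * ‖fderiv ℝ L x‖ := by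
  have hcont : Continuous fun y => ‖fderiv ℝ L y‖ * (r - dist y z) := by
    have := hL.continuous_fderiv (by norm_num)
    fun_prop
  obtain ⟨x, -, hmax⟩ := (isCompact_closedBall z r).exists_isMaxOn
    (Metric.nonempty_closedBall.2 hr.le) hcont.continuousOn
  set N := ‖fderiv ℝ L x‖ with hN
  set d := r - dist x z with hd
  have hmax' : ∀ y ∈ Metric.closedBall z r, ‖fderiv ℝ L y‖ * (r - dist y z) ≤ N * d :=
    fun y hy => hmax hy
  have hNd : 2 * ρ < N * d := by
    have := hmax' z (Metric.mem_closedBall_self hr.le)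
    rw [dist_self] at this
    linarith
  have hN0 : 0 < N := by
    refine (norm_nonneg _).lt_of_ne fun h => ?_
    rw [← hN] at h
    rw [← h] at hNd
    linarith
  have hd0 : 0 < d := by
    by_contra! h
    nlinarith
  have htρ : N⁻¹ * ρ < d / 2 := by
    rw [inv_mul_lt_iff₀ hN0]
    linarith
  have hdist : ∀ y ∈ Metric.ball x (N⁻¹ * ρ), d / 2 < r - dist y z := fun y hy => by
    have := dist_triangle y x z
    rw [Metric.mem_ball] at hy
    linarith
  refine ⟨x, N⁻¹, by positivity, inv_mul_cancel₀ hN0.ne', fun y hy => ?_, fun y hy => ?_⟩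
  · rw [Metric.mem_ball]
    linarith [hdist y hy]
  · have h1 := hdist y hy
    have h2 := hmax' y (by rw [Metric.mem_closedBall]; linarith)
    have h3 := mul_le_mul_of_nonneg_left h1.le (norm_nonneg (fderiv ℝ L y))
    exact le_of_mul_le_mul_right (by linarith) hd0

/-- Rescaled logarithms of solutions are profiles. -/
lemma isProfile_rescale {γ : ℝ} {L : Euc n → ℝ} (hL : ContDiff ℝ 2 L) {x : Euc n} {t : ℝ}
    (ht : 0 < t) (htx : t * ‖fderiv ℝ L x‖ = 1)
    (hle : ∀ y ∈ Metric.ball x (t * ρ), ‖fderiv ℝ L y‖ ≤ 2 * ‖fderiv ℝ L x‖)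
    (heq : ∀ y ∈ Metric.ball x (t * ρ), elaplacian L y + ‖fderiv ℝ L y‖ ^ 2 +
      ‖fderiv ℝ L y‖ ^ q * Real.exp (γ * L y) = 0) :
    IsProfile q γ (t ^ (2 - q) * Real.exp (γ * L x)) ρ (fun y => L (x + t • y) - L x) := by
  set g : Euc n → ℝ := fun y => L (x + t • y) with hg
  have hgC : ContDiff ℝ 2 g := hL.comp (by fun_prop)
  have hmem : ∀ y ∈ Metric.ball (0 : Euc n) ρ, x + t • y ∈ Metric.ball x (t * ρ) := fun y hy => by
    rw [mem_ball_zero_iff] at hy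
    rw [Metric.mem_ball, dist_self_add_left, norm_smul, Real.norm_of_nonneg ht.le]
    gcongr
  have hN : ∀ y, ‖fderiv ℝ (fun y => g y - L x) y‖ = t * ‖fderiv ℝ L (x + t • y)‖ := fun y => by
    rw [fderiv_sub_const, hg, norm_fderiv_comp_affine hL _ ht.le]
  have hlap : ∀ y, elaplacian (fun y => g y - L x) y = t ^ 2 * elaplacian L (x + t • y) :=
    fun y => by
      rw [← elaplacian_comp_affine hL]
      simp only [elaplacian, fderiv_sub_const, hg]
  refine ⟨hgC.sub contDiff_const, by simp, (hN 0).trans (by simpa using htx), fun y hy => ?_,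
    fun y hy => ?_⟩
  · have := mul_le_mul_of_nonneg_left (hle _ (hmem y hy)) ht.le
    rw [hN]
    linarith
  · have he := heq _ (hmem y hy)
    rw [hN, hlap, Real.mul_rpow ht.le (norm_nonneg _)]
    have h1 : t ^ (2 - q) * t ^ q = t ^ 2 := by
      rw [← Real.rpow_add ht, sub_add_cancel, Real.rpow_two]
    have h2 : Real.exp (γ * L x) * Real.exp (γ * (g y - L x)) = Real.exp (γ * g y) := by
      rw [← Real.exp_add]
      congr 1; ring
    calc _ = t ^ 2 * elaplacian L (x + t • y) + t ^ 2 * ‖fderiv ℝ L (x + t • y)‖ ^ 2 +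
          (t ^ (2 - q) * t ^ q) * ‖fderiv ℝ L (x + t • y)‖ ^ q *
            (Real.exp (γ * L x) * Real.exp (γ * (g y - L x))) := by ring
      _ = t ^ 2 * (elaplacian L (x + t • y) + ‖fderiv ℝ L (x + t • y)‖ ^ 2 +
          ‖fderiv ℝ L (x + t • y)‖ ^ q * Real.exp (γ * L (x + t • y))) := by rw [h1, h2]; ring
      _ = 0 := by rw [he, mul_zero]

lemma elaplacian_add_of_eventuallyEq_exp {u L : Euc n → ℝ} (hL : ContDiff ℝ 2 L) {x : Euc n}
    (h : u =ᶠ[𝓝 x] fun y => Real.exp (L y))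
    (hu : elaplacian u x + ‖gradient u x‖ ^ q * u x ^ p = 0) :
    elaplacian L x + ‖fderiv ℝ L x‖ ^ 2 +
      ‖fderiv ℝ L x‖ ^ q * Real.exp ((p + q - 1) * L x) = 0 := by
  have h' : u =ᶠ[𝓝 x] fun y => 1 * Real.exp (L y) := by simpa using h
  have hE := Real.exp_pos (L x)
  rw [norm_gradient_eq, elaplacian_congr h', h'.fderiv_eq, h'.eq_of_nhds, elaplacian_mul_exp hL,
    norm_fderiv_mul_exp hL zero_le_one, one_mul, Real.mul_rpow hE.le (norm_nonneg _)] at hu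
  have he : Real.exp (L x) ^ q * Real.exp (L x) ^ p =
      Real.exp (L x) * Real.exp ((p + q - 1) * L x) := by
    rw [← Real.exp_mul, ← Real.exp_mul, ← Real.exp_add, ← Real.exp_add]
    congr 1; ring
  refine (mul_eq_zero.1 (?_ : Real.exp (L x) * _ = 0)).resolve_left hE.ne'
  rw [← hu]
  linear_combination -‖fderiv ℝ L x‖ ^ q * he

lemma norm_fderiv_log_le (hρ : 0 < ρ)
    (hno : ∀ (a : ℝ) (l : Euc n → ℝ), IsScalable q (p + q - 1) a →
      ¬ IsProfile q (p + q - 1) a ρ l)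
    {u : Euc n → ℝ} {z : Euc n} {R : ℝ} (hR : 0 < R)
    (huC : ContDiffOn ℝ 2 u (Metric.ball z R)) (hu0 : ∀ x ∈ Metric.ball z R, 0 < u x)
    (hu : ∀ x ∈ Metric.ball z R, elaplacian u x + ‖gradient u x‖ ^ q * u x ^ p = 0) :
    ‖fderiv ℝ (fun x => Real.log (u x)) z‖ ≤ 4 * ρ / R := by
  obtain ⟨L, hL, hLu⟩ := exists_contDiff_eqOn_ball hR (huC.log fun x hx => (hu0 x hx).ne')
  have hsub : Metric.ball z (R / 2) ⊆ Metric.ball z R := Metric.ball_subset_ball (by linarith)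
  have hLuz : L =ᶠ[𝓝 z] fun x => Real.log (u x) :=
    hLu.eventuallyEq_of_mem (Metric.ball_mem_nhds z (by positivity))
  rw [← hLuz.fderiv_eq]
  by_contra! hcon
  rw [div_lt_iff₀ hR] at hcon
  obtain ⟨x, t, ht, htx, hball, hle⟩ :=
    exists_fderiv_le_two_mul hL (half_pos hR) hρ (z := z) (by linarith)
  refine hno _ _ ⟨by positivity, fun h1 h2 => by rw [h2, h1]; simp⟩
    (isProfile_rescale (q := q) (γ := p + q - 1) hL ht htx hle fun y hy => ?_)
  have hy := hball hy
  refine elaplacian_add_of_eventuallyEq_exp hL ?_ (hu y (hsub hy))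
  filter_upwards [Metric.isOpen_ball.mem_nhds hy] with w hw
  rw [hLu hw, Real.exp_log (hu0 w (hsub hw))]

end GradientEstimate

end

/-- **Theorem 1.6 (Harnack inequality).** If the Liouville property holds for `(p,q)` in
dimension `n`, then there is `C = C(n,p,q) > 0` such that every positive classical
solution of `Δu + |∇u|^q u^p = 0` on a ball `B(x₀, 2R)` satisfies
`sup_(B(x₀,R)) u ≤ C · inf_(B(x₀,R)) u`. -/
theorem harnack_of_liouville (n : ℕ) (hn : 2 ≤ n) (p q : ℝ) (hq : 0 ≤ q)
    (hLiou : ∀ u : EuclideanSpace ℝ (Fin n) → ℝ,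
      ContDiff ℝ 2 u → (∀ x, 0 < u x) →
      (∀ x, elaplacian u x + ‖gradient u x‖ ^ q * u x ^ p = 0) →
      ∀ x y, u x = u y) :
    ∃ C > (0 : ℝ), ∀ (x₀ : EuclideanSpace ℝ (Fin n)) (R : ℝ), 0 < R →
      ∀ u : EuclideanSpace ℝ (Fin n) → ℝ,
        ContDiffOn ℝ 2 u (Metric.ball x₀ (2 * R)) →
        (∀ x ∈ Metric.ball x₀ (2 * R), 0 < u x) →
        (∀ x ∈ Metric.ball x₀ (2 * R),
          elaplacian u x + ‖gradient u x‖ ^ q * u x ^ p = 0) →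
        ∀ x ∈ Metric.ball x₀ R, ∀ y ∈ Metric.ball x₀ R, u x ≤ C * u y := by
  obtain ⟨ρ, hρ, hno⟩ := exists_not_isProfile (by omega) hq hLiou
  refine ⟨Real.exp (8 * ρ), Real.exp_pos _, fun x₀ R hR u huC hu0 hu x hx y hy => ?_⟩
  have hsub : ∀ z ∈ Metric.ball x₀ R, Metric.ball z R ⊆ Metric.ball x₀ (2 * R) := fun z hz =>
    Metric.ball_subset_ball' (by rw [Metric.mem_ball] at hz; linarith)
  have hself : ∀ z ∈ Metric.ball x₀ R, z ∈ Metric.ball x₀ (2 * R) := fun z hz =>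
    hsub z hz (Metric.mem_ball_self hR)
  have hdiff : ∀ z ∈ Metric.ball x₀ R, DifferentiableAt ℝ (fun x => Real.log (u x)) z :=
    fun z hz => ((huC.contDiffAt (Metric.isOpen_ball.mem_nhds (hself z hz))).differentiableAt
      (by norm_num)).log (hu0 z (hself z hz)).ne'
  have hgrad : ∀ z ∈ Metric.ball x₀ R, ‖fderiv ℝ (fun x => Real.log (u x)) z‖ ≤ 4 * ρ / R :=
    fun z hz => norm_fderiv_log_le hρ hno hR (huC.mono (hsub z hz))
      (fun w hw => hu0 w (hsub z hz hw)) fun w hw => hu w (hsub z hz hw)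
  have hlog := (convex_ball x₀ R).norm_image_sub_le_of_norm_fderiv_le hdiff hgrad hy hx
  have hdist : ‖x - y‖ ≤ 2 * R := by
    rw [← dist_eq_norm]
    linarith [dist_triangle_right x y x₀, Metric.mem_ball.1 hx, Metric.mem_ball.1 hy]
  have hbound : 4 * ρ / R * ‖x - y‖ ≤ 8 * ρ := by
    calc _ ≤ 4 * ρ / R * (2 * R) := by gcongr
      _ = 8 * ρ := by field_simp; ring
  have hle : Real.log (u x) ≤ 8 * ρ + Real.log (u y) := by
    linarith [(le_abs_self _).trans hlog]
  rw [← Real.exp_log (hu0 x (hself x hx)), ← Real.exp_log (hu0 y (hself y hy)), ← Real.exp_add]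
  exact Real.exp_le_exp.2 hle
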